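/- For each k ≥ 0, the asymptotic density μ_k = lim_{n→∞} g_n^{(k)}/t_n of λυ-terms ψ-normalising in exactly k normal-order steps among all λυ-terms is an algebraic real number, i.e., it is a root of a non-zero polynomial with rational coefficients. -/

import Mathlib

mutual
/-- λυ-terms in de Bruijn notation, with explicit closures. -/
inductive LTerm : Type
  | idx : Nat → LTerm
  | lam : LTerm → LTerm
  | app : LTerm → LTerm → LTerm
  | clos : LTerm → LSub → LTerm
  deriving DecidableEq

/-- explicit λυ-substitutions. -/
inductive LSub : Type
  | slash : LTerm → LSub
  | lift : LSub → LSub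
  | shift : LSub
  deriving DecidableEq
end

mutual
/-- natural size of a λυ-term: the number of constructors (|idx n| = n+1). -/
def LTerm.size : LTerm → Nat
  | .idx n => n + 1
  | .lam a => 1 + a.size
  | .app a b => 1 + a.size + b.size
  | .clos a s => 1 + a.size + s.size

/-- natural size of a substitution. -/
def LSub.size : LSub → Nat
  | .slash a => 1 + a.size
  | .lift s => 1 + s.size
  | .shift => 1
end

/-- a λυ-term is pure if it contains no closure; pure terms are exactly the ψ-normal forms. -/
def LTerm.IsPure : LTerm → Prop
  | .idx _ => True
  | .lam a => a.IsPure
  | .app a b => a.IsPure ∧ b.IsPure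
  | .clos _ _ => False

/-- one normal-order (leftmost-outermost) ψ-reduction step. -/
inductive NStep : LTerm → LTerm → Prop
  /-- (App) (ab)[s] → a[s](b[s]) -/
  | appS (a b : LTerm) (s : LSub) :
      NStep (.clos (.app a b) s) (.app (.clos a s) (.clos b s))
  /-- (Lambda) (λa)[s] → λ(a[⇑(s)]) -/
  | lamS (a : LTerm) (s : LSub) :
      NStep (.clos (.lam a) s) (.lam (.clos a (.lift s)))
  /-- (FVar) 0[a/] → a -/
  | fvar (a : LTerm) : NStep (.clos (.idx 0) (.slash a)) a
  /-- (RVar) (S n)[a/] → n -/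
  | rvar (n : Nat) (a : LTerm) : NStep (.clos (.idx (n+1)) (.slash a)) (.idx n)
  /-- (FVarLift) 0[⇑(s)] → 0 -/
  | fvarLift (s : LSub) : NStep (.clos (.idx 0) (.lift s)) (.idx 0)
  /-- (RVarLift) (S n)[⇑(s)] → n[s][↑] -/
  | rvarLift (n : Nat) (s : LSub) :
      NStep (.clos (.idx (n+1)) (.lift s)) (.clos (.clos (.idx n) s) .shift)
  /-- (VarShift) n[↑] → S n -/
  | varShift (n : Nat) : NStep (.clos (.idx n) .shift) (.idx (n+1))
  /-- reduce under an abstraction -/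
  | lamCong {a a' : LTerm} : NStep a a' → NStep (.lam a) (.lam a')
  /-- reduce in the left part of an application -/
  | appLeft {a a' : LTerm} (b : LTerm) : NStep a a' → NStep (.app a b) (.app a' b)
  /-- reduce in the right part of an application, provided the left part is normal -/
  | appRight {b b' : LTerm} (a : LTerm) :
      a.IsPure → NStep b b' → NStep (.app a b) (.app a b')
  /-- reduce in the body of a closure, provided the closure is not itself a ψ-redex,
      i.e. its body is again a closure -/
  | closCong {t t' : LTerm} (s : LSub) :
      (∃ u v, t = LTerm.clos u v) → NStep t t' → NStep (.clos t s) (.clos t' s)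

/-- `NormIn t k` : `t` reaches its ψ-normal form in exactly `k` normal-order
ψ-reduction steps (written t ↓_k). -/
inductive NormIn : LTerm → Nat → Prop
  | base {t : LTerm} : t.IsPure → NormIn t 0
  | step {t t' : LTerm} {k : Nat} : NStep t t' → NormIn t' k → NormIn t (k+1)

/-- the number g_n^{(k)} of λυ-terms of size n that ψ-normalise in exactly k
normal-order ψ-reduction steps. -/
noncomputable def normCount (k n : ℕ) : ℕ :=
  Nat.card {t : LTerm // t.size = n ∧ NormIn t k}

/-- the total number t_n of λυ-terms of size n. -/
noncomputable def termCount (n : ℕ) : ℕ :=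
  Nat.card {t : LTerm // t.size = n}

namespace LambdaUpsilon

open Filter Topology PowerSeries Finset

/-- The `n`-th coefficient of a power series, rescaled by the radius of convergence `1/4`. -/
noncomputable def scaled (a : ℝ⟦X⟧) (n : ℕ) : ℝ := coeff n a * (1 / 4) ^ n

/-- The rescaled Catalan numbers. -/
noncomputable def catScaled (n : ℕ) : ℝ := (catalan n : ℝ) * (1 / 4) ^ n

lemma succ_succ_mul_catalan_succ (n : ℕ) :
    (n + 2) * catalan (n + 1) = 2 * (2 * n + 1) * catalan n := by
  have h1 := succ_mul_catalan_eq_centralBinom (n + 1)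
  have h2 := succ_mul_catalan_eq_centralBinom n
  have h3 := Nat.succ_mul_centralBinom_succ n
  rw [← h1, ← h2] at h3
  have h4 : (n + 1) * ((n + 2) * catalan (n + 1)) =
      (n + 1) * (2 * (2 * n + 1) * catalan n) := by
    rw [show n + 2 = n + 1 + 1 from rfl, h3]; ring
  exact Nat.eq_of_mul_eq_mul_left (Nat.succ_pos n) h4

lemma catScaled_succ (n : ℕ) :
    ((n : ℝ) + 2) * catScaled (n + 1) = ((n : ℝ) + 1 / 2) * catScaled n := by
  have h : ((n : ℝ) + 2) * catalan (n + 1) = 2 * (2 * n + 1) * catalan n := by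
    exact_mod_cast succ_succ_mul_catalan_succ n
  unfold catScaled
  rw [pow_succ, ← mul_assoc, ← mul_assoc, h]
  ring

lemma catScaled_zero : catScaled 0 = 1 := by simp [catScaled]

lemma catScaled_pos (n : ℕ) : 0 < catScaled n := by
  induction n with
  | zero => simp [catScaled_zero]
  | succ n ih =>
    have h := catScaled_succ n
    have : 0 < ((n : ℝ) + 1 / 2) * catScaled n := by positivity
    rw [← h] at this
    exact pos_of_mul_pos_right this (by positivity)

lemma catScaled_succ_div (n : ℕ) :
    catScaled (n + 1) / catScaled n = ((n : ℝ) + 1 / 2) / (n + 2) := by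
  have h := catScaled_succ n
  have := catScaled_pos n
  rw [div_eq_div_iff this.ne' (by positivity)]
  linarith

lemma monotone_sq_mul_catScaled : Monotone fun n : ℕ => ((n : ℝ) + 1) ^ 2 * catScaled n := by
  refine monotone_nat_of_le_succ fun n => ?_
  have h := catScaled_succ n
  have hp := catScaled_pos n
  have hq : catScaled (n + 1) = ((n : ℝ) + 1 / 2) / (n + 2) * catScaled n := by
    rw [div_mul_eq_mul_div, eq_div_iff (by positivity)]; linarith
  rw [hq]
  push_cast
  have : ((n : ℝ) + 1) ^ 2 ≤ ((n : ℝ) + 1 + 1) ^ 2 * (((n : ℝ) + 1 / 2) / (n + 2)) := by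
    rw [mul_div_assoc', le_div_iff₀ (by positivity)]
    nlinarith [sq_nonneg (n : ℝ), Nat.cast_nonneg (α := ℝ) n]
  calc _ ≤ (((n : ℝ) + 1 + 1) ^ 2 * (((n : ℝ) + 1 / 2) / (n + 2))) * catScaled n := by gcongr
    _ = _ := by ring

lemma inv_sq_le_catScaled (n : ℕ) : 1 ≤ ((n : ℝ) + 1) ^ 2 * catScaled n := by
  simpa [catScaled_zero] using monotone_sq_mul_catScaled (Nat.zero_le n)

lemma catScaled_sub_le {n k : ℕ} (h : 2 * k ≤ n) :
    catScaled (n - k) / catScaled n ≤ 4 := by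
  rw [div_le_iff₀ (catScaled_pos n)]
  have hm := monotone_sq_mul_catScaled (Nat.sub_le n k)
  have h2 : ((n : ℝ) + 1) ^ 2 ≤ 4 * ((n - k : ℕ) + 1 : ℝ) ^ 2 := by
    have : (n : ℝ) + 1 ≤ 2 * (((n - k : ℕ) : ℝ) + 1) := by
      have : n + 1 ≤ 2 * ((n - k) + 1) := by omega
      exact_mod_cast this
    calc _ ≤ (2 * (((n - k : ℕ) : ℝ) + 1)) ^ 2 := by gcongr
      _ = _ := by ring
  have hp := catScaled_pos n
  have : 0 < ((n - k : ℕ) + 1 : ℝ) ^ 2 := by positivity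
  refine le_of_mul_le_mul_left ?_ this
  calc _ ≤ ((n : ℝ) + 1) ^ 2 * catScaled n := hm
    _ ≤ (4 * ((n - k : ℕ) + 1 : ℝ) ^ 2) * catScaled n := by gcongr
    _ = _ := by ring

lemma tendsto_catScaled_succ_div :
    Tendsto (fun n => catScaled (n + 1) / catScaled n) atTop (𝓝 1) := by
  simp_rw [catScaled_succ_div]
  have h : Tendsto (fun n : ℕ => 1 - (3 / 2) / ((n : ℝ) + 2)) atTop (𝓝 (1 - 0)) := by
    refine tendsto_const_nhds.sub (tendsto_const_nhds.div_atTop ?_)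
    exact tendsto_atTop_add_const_right _ _ tendsto_natCast_atTop_atTop
  rw [sub_zero] at h
  refine h.congr fun n => ?_
  have : (n : ℝ) + 2 ≠ 0 := by positivity
  field_simp
  ring

lemma tendsto_catScaled_sub_div (k : ℕ) :
    Tendsto (fun n => catScaled (n - k) / catScaled n) atTop (𝓝 1) := by
  rw [← tendsto_add_atTop_iff_nat k]
  simp only [Nat.add_sub_cancel]
  induction k with
  | zero => simpa using tendsto_const_nhds.congr fun n => (div_self (catScaled_pos n).ne').symm
  | succ k ih =>
    have h := (tendsto_catScaled_succ_div.comp (tendsto_add_atTop_nat k)).inv₀ one_ne_zero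
    have h2 := ih.mul h
    simp only [inv_one, mul_one] at h2
    refine h2.congr fun n => ?_
    have h1 := (catScaled_pos (n + k)).ne'
    have h3 := (catScaled_pos (n + k + 1)).ne'
    simp only [Function.comp, ← add_assoc, inv_div]
    field_simp

/-- Convolving along the indices `k ≤ n / 2` transfers the asymptotics of the second factor. -/
lemma tendsto_half_convolution {a b : ℕ → ℝ} {β : ℝ} (p : ℕ → ℕ → Prop)
    [∀ n k, Decidable (p n k)] (hp : ∀ n k, p n k → 2 * k ≤ n)
    (hp' : ∀ k, ∀ᶠ n in atTop, p n k)
    (ha : Summable fun n => |a n|) (hb : Tendsto (fun n => b n / catScaled n) atTop (𝓝 β)) :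
    Tendsto (fun n => ∑' k, if p n k then a k * b (n - k) / catScaled n else 0) atTop
      (𝓝 (∑' k, a k * β)) := by
  obtain ⟨B, hB⟩ := (hb.abs).bddAbove_range
  have hB' : ∀ n, |b n| ≤ B * catScaled n := fun n => by
    have := hB ⟨n, rfl⟩
    simp only [abs_div, abs_of_pos (catScaled_pos n)] at this
    rwa [div_le_iff₀ (catScaled_pos n)] at this
  have hB0 : 0 ≤ B := by
    have := (abs_nonneg _).trans (hB' 0)
    rwa [catScaled_zero, mul_one] at this
  refine tendsto_tsum_of_dominated_convergence (bound := fun k => |a k| * (B * 4))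
    (ha.mul_right _) ?_ (Eventually.of_forall fun n k => ?_)
  · intro k
    have h1 : Tendsto (fun n => b (n - k) / catScaled (n - k)) atTop (𝓝 β) :=
      hb.comp (tendsto_sub_atTop_nat k)
    have h2 := ((h1.mul (tendsto_catScaled_sub_div k)).const_mul (a k))
    rw [mul_one] at h2
    refine h2.congr' ?_
    filter_upwards [hp' k] with n hn
    rw [if_pos hn]
    have := (catScaled_pos (n - k)).ne'
    field_simp
  · split_ifs with h
    · rw [Real.norm_eq_abs, abs_div, abs_mul, abs_of_pos (catScaled_pos n), mul_div_assoc]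
      refine mul_le_mul_of_nonneg_left ?_ (abs_nonneg _)
      calc |b (n - k)| / catScaled n ≤ B * catScaled (n - k) / catScaled n := by
            have := (catScaled_pos n)
            gcongr
            exact hB' _
        _ = B * (catScaled (n - k) / catScaled n) := by ring
        _ ≤ B * 4 := by gcongr; exact catScaled_sub_le (hp n k h)
    · simp; positivity

lemma tendsto_convolution {a b : ℕ → ℝ} {α β : ℝ}
    (ha : Summable fun n => |a n|) (hb : Summable fun n => |b n|)
    (ha' : Tendsto (fun n => a n / catScaled n) atTop (𝓝 α))
    (hb' : Tendsto (fun n => b n / catScaled n) atTop (𝓝 β)) :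
    Tendsto (fun n => (∑ p ∈ antidiagonal n, a p.1 * b p.2) / catScaled n) atTop
      (𝓝 ((∑' k, a k) * β + (∑' k, b k) * α)) := by
  have h1 := tendsto_half_convolution (fun n k => 2 * k ≤ n) (fun _ _ h => h)
    (fun k => eventually_ge_atTop _) ha hb'
  have h2 := tendsto_half_convolution (fun n k => 2 * k < n) (fun _ _ h => h.le)
    (fun k => eventually_gt_atTop _) hb ha'
  rw [tsum_mul_right] at h1 h2
  refine (h1.add h2).congr fun n => ?_
  rw [tsum_eq_sum (s := range (n + 1)), tsum_eq_sum (s := range (n + 1)),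
    Finset.Nat.sum_antidiagonal_eq_sum_range_succ (fun i j => a i * b j), Finset.sum_div,
    ← Finset.sum_range_reflect (fun k => if 2 * k < n then b k * a (n - k) / catScaled n else 0),
    ← Finset.sum_add_distrib]
  · refine Finset.sum_congr rfl fun k hk => ?_
    have hk' : k ≤ n := Nat.lt_succ_iff.mp (Finset.mem_range.mp hk)
    have e1 : n + 1 - 1 - k = n - k := by omega
    have e2 : n - (n - k) = k := by omega
    rw [e1, e2]
    by_cases h : 2 * k ≤ n
    · rw [if_pos h, if_neg (by omega), add_zero]
    · rw [if_neg h, if_pos (by omega), zero_add, mul_comm]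
  · intro k hk
    rw [if_neg]
    simp at hk; omega
  · intro k hk
    rw [if_neg]
    simp at hk; omega

lemma scaled_mul (a b : ℝ⟦X⟧) (n : ℕ) :
    scaled (a * b) n = ∑ p ∈ antidiagonal n, scaled a p.1 * scaled b p.2 := by
  unfold scaled
  rw [coeff_mul, Finset.sum_mul]
  refine Finset.sum_congr rfl fun p hp => ?_
  rw [← HasAntidiagonal.mem_antidiagonal.mp hp, pow_add]
  ring

lemma scaled_add (a b : ℝ⟦X⟧) (n : ℕ) : scaled (a + b) n = scaled a n + scaled b n := by
  simp [scaled, add_mul]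

lemma scaled_smul (c : ℚ) (a : ℝ⟦X⟧) (n : ℕ) : scaled (c • a) n = c * scaled a n := by
  simp [scaled, mul_assoc, Rat.smul_def]

/-- Power series with an algebraic value at `1/4` whose coefficients are asymptotically an
algebraic multiple of the Catalan numbers. -/
structure AlgCatalan (a : ℝ⟦X⟧) : Prop where
  summable : Summable fun n => |scaled a n|
  value : IsAlgebraic ℚ (∑' n, scaled a n)
  limit : ∃ α, IsAlgebraic ℚ α ∧ Tendsto (fun n => scaled a n / catScaled n) atTop (𝓝 α)

lemma tsum_scaled_mul {a b : ℝ⟦X⟧} (ha : Summable fun n => |scaled a n|)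
    (hb : Summable fun n => |scaled b n|) :
    ∑' n, scaled (a * b) n = (∑' n, scaled a n) * ∑' n, scaled b n := by
  simp_rw [scaled_mul]
  simp_rw [← Real.norm_eq_abs] at ha hb
  exact (tsum_mul_tsum_eq_tsum_sum_antidiagonal_of_summable_norm ha hb).symm

lemma summable_scaled_mul {a b : ℝ⟦X⟧} (ha : Summable fun n => |scaled a n|)
    (hb : Summable fun n => |scaled b n|) : Summable fun n => |scaled (a * b) n| := by
  simp_rw [scaled_mul]
  simp_rw [← Real.norm_eq_abs] at ha hb ⊢
  exact summable_norm_sum_mul_antidiagonal_of_summable_norm ha hb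

lemma tsum_scaled_add {a b : ℝ⟦X⟧} (ha : Summable fun n => |scaled a n|)
    (hb : Summable fun n => |scaled b n|) :
    ∑' n, scaled (a + b) n = (∑' n, scaled a n) + ∑' n, scaled b n := by
  simp_rw [scaled_add]
  exact ha.of_abs.tsum_add hb.of_abs

lemma AlgCatalan.mul {a b : ℝ⟦X⟧} (ha : AlgCatalan a) (hb : AlgCatalan b) :
    AlgCatalan (a * b) := by
  obtain ⟨sa, va, α, hα, la⟩ := ha
  obtain ⟨sb, vb, β, hβ, lb⟩ := hb
  refine ⟨summable_scaled_mul sa sb, ?_, _, (va.mul hβ).add (vb.mul hα), ?_⟩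
  · rw [tsum_scaled_mul sa sb]; exact va.mul vb
  · simp_rw [scaled_mul]
    exact tendsto_convolution sa sb la lb

lemma AlgCatalan.add {a b : ℝ⟦X⟧} (ha : AlgCatalan a) (hb : AlgCatalan b) :
    AlgCatalan (a + b) := by
  obtain ⟨sa, va, α, hα, la⟩ := ha
  obtain ⟨sb, vb, β, hβ, lb⟩ := hb
  refine ⟨?_, ?_, _, hα.add hβ, ?_⟩
  · refine Summable.of_nonneg_of_le (fun _ => abs_nonneg _) (fun n => ?_) (sa.add sb)
    rw [scaled_add]; exact abs_add_le _ _
  · rw [tsum_scaled_add sa sb]; exact va.add vb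
  · refine (la.add lb).congr fun n => ?_
    rw [scaled_add, add_div]

lemma AlgCatalan.smul (c : ℚ) {a : ℝ⟦X⟧} (ha : AlgCatalan a) : AlgCatalan (c • a) := by
  obtain ⟨sa, va, α, hα, la⟩ := ha
  have hc : IsAlgebraic ℚ (c : ℝ) := isAlgebraic_algebraMap c
  refine ⟨?_, ?_, _, hc.mul hα, ?_⟩
  · simp_rw [scaled_smul, abs_mul]; exact sa.mul_left _
  · simp_rw [scaled_smul]; rw [tsum_mul_left]; exact hc.mul va
  · simp_rw [scaled_smul, mul_div_assoc]; exact la.const_mul _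

/-- A power series whose coefficients grow with exponential rate smaller than `4`. -/
lemma AlgCatalan.of_le {a : ℝ⟦X⟧} {C r : ℝ} (hr0 : 0 ≤ r) (hr : r < 1)
    (h : ∀ n, |scaled a n| ≤ C * r ^ n) (hv : IsAlgebraic ℚ (∑' n, scaled a n)) :
    AlgCatalan a := by
  refine ⟨Summable.of_nonneg_of_le (fun _ => abs_nonneg _) h
    ((summable_geometric_of_lt_one hr0 hr).mul_left C), hv, 0, isAlgebraic_zero, ?_⟩
  have hC : 0 ≤ C := by simpa using (abs_nonneg _).trans (h 0)
  have ht : Tendsto (fun n : ℕ => C / r * ((((n + 1 : ℕ) : ℝ)) ^ 2 * r ^ (n + 1))) atTop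
      (𝓝 (C / r * 0)) :=
    ((tendsto_pow_const_mul_const_pow_of_abs_lt_one 2 (abs_lt.mpr ⟨by linarith, hr⟩)).comp
      (tendsto_add_atTop_nat 1)).const_mul _
  rcases hr0.eq_or_lt with rfl | hr0
  · refine tendsto_const_nhds.congr' ?_
    filter_upwards [eventually_gt_atTop 0] with n hn
    have := h n
    rw [zero_pow hn.ne', mul_zero] at this
    simp [abs_nonpos_iff.mp this]
  rw [mul_zero] at ht
  refine squeeze_zero_norm (fun n => ?_) ht
  rw [Real.norm_eq_abs, abs_div, abs_of_pos (catScaled_pos n), div_le_iff₀ (catScaled_pos n)]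
  have h1 := inv_sq_le_catScaled n
  have e : C / r * ((((n + 1 : ℕ) : ℝ)) ^ 2 * r ^ (n + 1)) * catScaled n
      = C * r ^ n * (((n : ℝ) + 1) ^ 2 * catScaled n) := by
    push_cast; field_simp; ring
  rw [e]
  exact (h n).trans (le_mul_of_one_le_right (by positivity) h1)

/-- A power series with non-negative coefficients and bounded partial sums beyond `1/4`. -/
lemma AlgCatalan.of_sum_le {a : ℝ⟦X⟧} (h0 : ∀ n, 0 ≤ coeff n a) {C r : ℝ} (hr : 1 / 4 < r)
    (h : ∀ n, ∑ i ∈ range n, coeff i a * r ^ i ≤ C) (hv : IsAlgebraic ℚ (∑' n, scaled a n)) :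
    AlgCatalan a := by
  have hr0 : 0 < r := by linarith
  refine AlgCatalan.of_le (C := C) (r := 1 / 4 / r) (by positivity)
    ((div_lt_one (by linarith)).mpr hr) (fun n => ?_) hv
  have h1 : coeff n a * r ^ n ≤ C := by
    refine le_trans ?_ (h (n + 1))
    exact Finset.single_le_sum (f := fun i => coeff i a * r ^ i)
      (fun i _ => mul_nonneg (h0 i) (by positivity)) (Finset.self_mem_range_succ n)
  unfold scaled
  rw [abs_of_nonneg (mul_nonneg (h0 n) (by positivity)), div_pow _ r, ← mul_div_assoc,
    le_div_iff₀ (by positivity)]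
  calc _ = coeff n a * r ^ n * (1 / 4) ^ n := by ring
    _ ≤ _ := by gcongr

lemma summable_scaled_of_sum_le {a : ℝ⟦X⟧} (h0 : ∀ n, 0 ≤ coeff n a) {C r : ℝ}
    (hr : 1 / 4 ≤ r)
    (h : ∀ n, ∑ i ∈ range n, coeff i a * r ^ i ≤ C) : Summable fun n => |scaled a n| := by
  refine summable_of_sum_range_le (c := C) (fun _ => abs_nonneg _) fun n => ?_
  refine le_trans (Finset.sum_le_sum fun i _ => ?_) (h n)
  unfold scaled
  rw [abs_of_nonneg (mul_nonneg (h0 i) (by positivity))]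
  have := h0 i
  gcongr

lemma sum_coeff_mul_le {a b : ℝ⟦X⟧} (ha : ∀ n, 0 ≤ coeff n a) (hb : ∀ n, 0 ≤ coeff n b)
    {r : ℝ} (hr : 0 ≤ r) (n : ℕ) :
    ∑ i ∈ range n, coeff i (a * b) * r ^ i ≤
      (∑ i ∈ range n, coeff i a * r ^ i) * ∑ i ∈ range n, coeff i b * r ^ i := by
  rw [Finset.sum_mul_sum, ← Finset.sum_product']
  simp_rw [coeff_mul, Finset.sum_mul]
  rw [Finset.sum_sigma']
  have hmap : Set.InjOn (fun x : (_ : ℕ) × ℕ × ℕ => x.2)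
      ((range n).sigma fun i => antidiagonal i : Finset ((_ : ℕ) × ℕ × ℕ)) := by
    rintro ⟨i, p⟩ h ⟨j, q⟩ h' (rfl : p = q)
    simp only [coe_sigma, Set.mem_sigma_iff, Finset.mem_coe, HasAntidiagonal.mem_antidiagonal]
      at h h'
    obtain rfl : i = j := h.2.symm.trans h'.2
    rfl
  calc _ = ∑ p ∈ ((range n).sigma fun i => antidiagonal i).image (fun x => x.2),
        coeff p.1 a * r ^ p.1 * (coeff p.2 b * r ^ p.2) := by
        rw [Finset.sum_image hmap]
        refine Finset.sum_congr rfl fun x hx => ?_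
        rw [← (HasAntidiagonal.mem_antidiagonal.mp (mem_sigma.mp hx).2), pow_add]
        ring
    _ ≤ _ := by
        refine Finset.sum_le_sum_of_subset_of_nonneg ?_ fun p _ _ => ?_
        · intro p hp
          simp only [Finset.mem_image, mem_sigma, mem_range, HasAntidiagonal.mem_antidiagonal] at hp
          obtain ⟨x, ⟨h1, h2⟩, rfl⟩ := hp
          simp only [mem_product, mem_range]
          omega
        · have := ha p.1
          have := hb p.2
          positivity

lemma sum_coeff_X_mul (a : ℝ⟦X⟧) (r : ℝ) (n : ℕ) :
    ∑ i ∈ range (n + 1), coeff i (X * a) * r ^ i = r * ∑ i ∈ range n, coeff i a * r ^ i := by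
  rw [Finset.sum_range_succ', Finset.mul_sum]
  simp only [coeff_succ_X_mul, coeff_zero_X_mul, zero_mul, add_zero]
  exact Finset.sum_congr rfl fun i _ => by rw [pow_succ]; ring

lemma scaled_X_summable : Summable fun n => |scaled X n| := by
  refine summable_of_ne_finset_zero (s := {1}) fun n hn => ?_
  simp only [Finset.mem_singleton] at hn
  simp [scaled, coeff_X, hn]

lemma tsum_scaled_X : ∑' n, scaled X n = 1 / 4 := by
  rw [tsum_eq_single 1]
  · simp [scaled]
  · intro n hn
    simp [scaled, coeff_X, hn]

lemma scaled_one_summable : Summable fun n => |scaled 1 n| := by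
  refine summable_of_ne_finset_zero (s := {0}) fun n hn => ?_
  simp only [Finset.mem_singleton] at hn
  simp [scaled, coeff_one, hn]

lemma tsum_scaled_one : ∑' n, scaled 1 n = 1 := by
  rw [tsum_eq_single 0]
  · simp [scaled]
  · intro n hn
    simp [scaled, coeff_one, hn]

lemma isAlgebraic_ratCast (q : ℚ) : IsAlgebraic ℚ (q : ℝ) := isAlgebraic_algebraMap q

lemma AlgCatalan.X : AlgCatalan (X : ℝ⟦X⟧) := by
  refine AlgCatalan.of_le (C := 1) (r := 1 / 4) (by norm_num) (by norm_num) (fun n => ?_) ?_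
  · simp only [scaled, coeff_X]
    split_ifs <;> simp
  · rw [tsum_scaled_X]; simpa using isAlgebraic_ratCast (1 / 4)

lemma AlgCatalan.one : AlgCatalan (1 : ℝ⟦X⟧) := by
  refine AlgCatalan.of_le (C := 1) (r := 1 / 4) (by norm_num) (by norm_num) (fun n => ?_) ?_
  · simp only [scaled, coeff_one]
    split_ifs <;> simp
  · rw [tsum_scaled_one]; exact isAlgebraic_one

/-- The series `1 / (1 - z)`. -/
noncomputable def geom : ℝ⟦X⟧ := PowerSeries.mk fun _ => 1

lemma geom_eq : geom = 1 + X * geom := by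
  ext n
  cases n <;> simp [geom, coeff_one]

lemma AlgCatalan.geom : AlgCatalan geom := by
  refine AlgCatalan.of_le (C := 1) (r := 1 / 4) (by norm_num) (by norm_num) (fun n => ?_) ?_
  · simp [scaled, LambdaUpsilon.geom]
  · simp only [scaled, LambdaUpsilon.geom, coeff_mk, one_mul]
    rw [tsum_geometric_of_lt_one (by norm_num) (by norm_num)]
    convert isAlgebraic_ratCast (4 / 3) using 1
    norm_num

/-- The power series which are `AlgCatalan`. -/
noncomputable def algCatalan : Submodule ℚ ℝ⟦X⟧ where
  carrier := {a | AlgCatalan a}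
  add_mem' := AlgCatalan.add
  zero_mem' := by simpa using AlgCatalan.one.smul 0
  smul_mem' c _ h := h.smul c

lemma mem_algCatalan {a : ℝ⟦X⟧} : a ∈ algCatalan ↔ AlgCatalan a := Iff.rfl

lemma not_isPure_of_nStep {t t' : LTerm} (h : NStep t t') : ¬ t.IsPure := by
  induction h with
  | lamCong _ ih => simpa [LTerm.IsPure] using ih
  | appLeft _ _ ih => simp [LTerm.IsPure, ih]
  | appRight _ _ _ ih => simp [LTerm.IsPure, ih]
  | _ => simp [LTerm.IsPure]

lemma nStep_deterministic {t t₁ : LTerm} (h : NStep t t₁) : ∀ {t₂}, NStep t t₂ → t₁ = t₂ := by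
  induction h with
  | lamCong _ ih =>
    intro t₂ h₂
    cases h₂ with
    | lamCong h => rw [ih h]
  | appLeft b h₁ ih =>
    intro t₂ h₂
    cases h₂ with
    | appLeft _ h => rw [ih h]
    | appRight _ hp h => exact absurd hp (not_isPure_of_nStep h₁)
  | appRight a hp h₁ ih =>
    intro t₂ h₂
    cases h₂ with
    | appLeft _ h => exact absurd hp (not_isPure_of_nStep h)
    | appRight _ _ h => rw [ih h]
  | closCong s hc h₁ ih =>
    intro t₂ h₂
    obtain ⟨u, v, rfl⟩ := hc
    cases h₂ with
    | closCong _ _ h => rw [ih h]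
  | _ =>
    intro t₂ h₂
    cases h₂ with
    | closCong _ hc _ => obtain ⟨u, v, hc⟩ := hc; cases hc
    | _ => rfl

lemma normIn_zero {t : LTerm} : NormIn t 0 ↔ t.IsPure :=
  ⟨fun h => by cases h; assumption, .base⟩

lemma normIn_succ {t t' : LTerm} (h : NStep t t') {k : ℕ} :
    NormIn t (k + 1) ↔ NormIn t' k := by
  refine ⟨fun h' => ?_, .step h⟩
  cases h' with
  | step h₁ h₂ => rwa [nStep_deterministic h h₁]

lemma normIn_unique {t : LTerm} {i : ℕ} (h : NormIn t i) : ∀ {j}, NormIn t j → i = j := by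
  induction h with
  | base hp =>
    intro j hj
    cases hj with
    | base => rfl
    | step h _ => exact absurd hp (not_isPure_of_nStep h)
  | step h _ ih =>
    intro j hj
    cases hj with
    | base hp => exact absurd hp (not_isPure_of_nStep h)
    | step h' hk => rw [ih (nStep_deterministic h h' ▸ hk)]

lemma normIn_lam {a : LTerm} {k : ℕ} : NormIn (.lam a) k ↔ NormIn a k := by
  induction k generalizing a with
  | zero => simp [normIn_zero, LTerm.IsPure]
  | succ k ih =>
    constructor
    · rintro (_ | ⟨h, h'⟩)
      cases h with
      | lamCong h => exact .step h (ih.mp h')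
    · rintro (_ | ⟨h, h'⟩)
      exact .step (.lamCong h) (ih.mpr h')

lemma normIn_app {a b : LTerm} {k : ℕ} :
    NormIn (.app a b) k ↔ ∃ p ∈ HasAntidiagonal.antidiagonal k, NormIn a p.1 ∧ NormIn b p.2 := by
  constructor
  · intro h
    generalize ht : LTerm.app a b = t at h
    induction h generalizing a b with
    | base hp =>
      subst ht
      exact ⟨(0, 0), by simp, .base hp.1, .base hp.2⟩
    | step h _ ih =>
      subst ht
      cases h with
      | appLeft _ h =>
        obtain ⟨p, hp, h₁, h₂⟩ := ih rfl
        simp only [HasAntidiagonal.mem_antidiagonal] at hp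
        exact ⟨(p.1 + 1, p.2), by simp; omega, .step h h₁, h₂⟩
      | appRight _ hpure h =>
        obtain ⟨p, hp, h₁, h₂⟩ := ih rfl
        simp only [HasAntidiagonal.mem_antidiagonal] at hp
        exact ⟨(p.1, p.2 + 1), by simp; omega, h₁, .step h h₂⟩
  · rintro ⟨⟨i, j⟩, hp, h₁, h₂⟩
    simp only [HasAntidiagonal.mem_antidiagonal] at hp h₁ h₂
    subst hp
    induction h₁ with
    | base hp =>
      rw [zero_add]
      induction h₂ with
      | base hp' => exact .base ⟨hp, hp'⟩
      | step h _ ih => exact .step (.appRight _ hp h) ih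
    | step h _ ih =>
      rw [add_right_comm]
      exact .step (.appLeft _ h) ih

/-- The iterated closure `t[s₁]…[sₘ]`. -/
def chain (t : LTerm) (v : List LSub) : LTerm := v.foldl .clos t

@[simp] lemma chain_nil (t : LTerm) : chain t [] = t := rfl

@[simp] lemma chain_cons (t : LTerm) (s : LSub) (v : List LSub) :
    chain t (s :: v) = chain (.clos t s) v := rfl

lemma nStep_chain {t t' : LTerm} (ht : ∃ u s, t = .clos u s) (h : NStep t t') (v : List LSub) :
    NStep (chain t v) (chain t' v) := by
  induction v using List.reverseRecOn with
  | nil => exact h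
  | append_singleton v s ih =>
    simp only [chain, List.foldl_append, List.foldl_cons, List.foldl_nil] at ih ⊢
    refine .closCong s ?_ ih
    rcases v.eq_nil_or_concat with rfl | ⟨v', s', rfl⟩
    · exact ht
    · exact ⟨v'.foldl .clos t, s', by simp⟩

lemma normIn_chain_succ {u t' : LTerm} {s : LSub} (h : NStep (.clos u s) t') (v : List LSub)
    (k : ℕ) : NormIn (chain (.clos u s) v) (k + 1) ↔ NormIn (chain t' v) k :=
  normIn_succ (nStep_chain ⟨_, _, rfl⟩ h v)

lemma normIn_chain_app (a b : LTerm) (v : List LSub) (k : ℕ) :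
    NormIn (chain (.app a b) v) (k + v.length) ↔
      ∃ p ∈ HasAntidiagonal.antidiagonal k, NormIn (chain a v) p.1 ∧ NormIn (chain b v) p.2 := by
  induction v generalizing a b with
  | nil => exact normIn_app
  | cons s v ih =>
    rw [chain_cons, List.length_cons, ← add_assoc, normIn_chain_succ (.appS a b s), ih]
    rfl

lemma normIn_chain_lam (a : LTerm) (v : List LSub) (k : ℕ) :
    NormIn (chain (.lam a) v) (k + v.length) ↔ NormIn (chain a (v.map .lift)) k := by
  induction v generalizing a with
  | nil => exact normIn_lam
  | cons s v ih =>
    rw [chain_cons, List.length_cons, ← add_assoc, normIn_chain_succ (.lamS a s), ih]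
    rfl

/-- The number of closures on top of a term. -/
def spine : LTerm → ℕ
  | .clos t _ => spine t + 1
  | _ => 0

lemma spine_le_of_nStep {t t' : LTerm} (h : NStep t t') : spine t ≤ spine t' + 1 := by
  induction h <;> simp_all [spine]

lemma spine_le_of_normIn {t : LTerm} {k : ℕ} (h : NormIn t k) : spine t ≤ k := by
  induction h with
  | @base t hp => cases t <;> simp_all [spine, LTerm.IsPure]
  | step h _ ih => exact (spine_le_of_nStep h).trans (by omega)

lemma length_le_spine_chain (t : LTerm) (v : List LSub) : v.length ≤ spine (chain t v) := by
  induction v using List.reverseRecOn with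
  | nil => simp
  | append_singleton v s ih =>
    simp only [chain, List.foldl_append, List.foldl_cons, List.foldl_nil, spine,
      List.length_append, List.length_singleton] at ih ⊢
    omega

lemma length_le_of_normIn_chain {t : LTerm} {v : List LSub} {k : ℕ} (h : NormIn (chain t v) k) :
    v.length ≤ k :=
  (length_le_spine_chain t v).trans (spine_le_of_normIn h)

section Spaces

/-- The function on indices `p`, extended by zero to all terms. -/
def idxFn (p : ℕ → ℚ) : LTerm → ℚ
  | .idx n => p n
  | _ => 0

/-- The function `λa ↦ f a`, extended by zero to all terms. -/
def lamFn (f : LTerm → ℚ) : LTerm → ℚ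
  | .lam a => f a
  | _ => 0

/-- The function `a b ↦ f a * g b`, extended by zero to all terms. -/
def appFn (f g : LTerm → ℚ) : LTerm → ℚ
  | .app a b => f a * g b
  | _ => 0

/-- The function `a[s] ↦ f a * g s`, extended by zero to all terms. -/
def closFn (f : LTerm → ℚ) (g : LSub → ℚ) : LTerm → ℚ
  | .clos a s => f a * g s
  | _ => 0

/-- The function `a/ ↦ f a`, extended by zero to all substitutions. -/
def slashFn (f : LTerm → ℚ) : LSub → ℚ
  | .slash a => f a
  | _ => 0

/-- The function `⇑(s) ↦ g s`, extended by zero to all substitutions. -/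
def liftFn (g : LSub → ℚ) : LSub → ℚ
  | .lift s => g s
  | _ => 0

/-- The indicator function of `↑`. -/
def shiftFn : LSub → ℚ
  | .shift => 1
  | _ => 0

open Classical in
/-- The indicator function of the terms normalising in `k` steps. -/
noncomputable def ind (k : ℕ) : LTerm → ℚ := fun t => if NormIn t k then 1 else 0

lemma ind_mul_ind (i j : ℕ) : ind i * ind j = if i = j then ind i else 0 := by
  funext t
  split_ifs with h
  · subst h; simp [ind]
  · simp only [ind, Pi.mul_apply, Pi.zero_apply]
    split_ifs with h1 h2
    · exact absurd (normIn_unique h1 h2) h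
    all_goals simp

/-- Eventually constant functions. -/
def EvConst (p : ℕ → ℚ) : Prop := ∃ M c, ∀ n ≥ M, p n = c

/-- Functions on terms built from one constructor. -/
inductive TermGen (A : Submodule ℚ (LTerm → ℚ)) (B : Submodule ℚ (LSub → ℚ)) :
    (LTerm → ℚ) → Prop
  | idx {p : ℕ → ℚ} : EvConst p → TermGen A B (idxFn p)
  | lam {f : LTerm → ℚ} : f ∈ A → TermGen A B (lamFn f)
  | app {f g : LTerm → ℚ} : f ∈ A → g ∈ A → TermGen A B (appFn f g)
  | clos {f : LTerm → ℚ} {g : LSub → ℚ} : f ∈ A → g ∈ B → TermGen A B (closFn f g)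

/-- Functions on substitutions built from one constructor. -/
inductive SubGen (A : Submodule ℚ (LTerm → ℚ)) (B : Submodule ℚ (LSub → ℚ)) :
    (LSub → ℚ) → Prop
  | slash {f : LTerm → ℚ} : f ∈ A → SubGen A B (slashFn f)
  | lift {g : LSub → ℚ} : g ∈ B → SubGen A B (liftFn g)
  | shift : SubGen A B shiftFn

/-- The constant one and the indicators `ind i` with `2 * i ≤ w`. -/
inductive IndGen (w : ℕ) : (LTerm → ℚ) → Prop
  | one : IndGen w 1
  | ind {i : ℕ} : 2 * i ≤ w → IndGen w (ind i)

/-- The spaces of functions on terms and on substitutions of complexity `w`. -/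
def level : ℕ → Submodule ℚ (LTerm → ℚ) × Submodule ℚ (LSub → ℚ)
  | 0 => (Submodule.span ℚ {f | IndGen 0 f}, Submodule.span ℚ {1})
  | w + 1 =>
    (Submodule.span ℚ {f | ∃ b e, TermGen (level w).1 (level w).2 b ∧ IndGen (w + 1) e ∧ f = b * e},
      Submodule.span ℚ {g | SubGen (level w).1 (level w).2 g})

/-- The functions on terms of complexity `w`. -/
abbrev termLevel (w : ℕ) : Submodule ℚ (LTerm → ℚ) := (level w).1

/-- The functions on substitutions of complexity `w`. -/
abbrev subLevel (w : ℕ) : Submodule ℚ (LSub → ℚ) := (level w).2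

lemma termLevel_zero : termLevel 0 = Submodule.span ℚ {f | IndGen 0 f} := rfl

lemma subLevel_zero : subLevel 0 = Submodule.span ℚ {1} := rfl

lemma termLevel_succ (w : ℕ) : termLevel (w + 1) = Submodule.span ℚ
    {f | ∃ b e, TermGen (termLevel w) (subLevel w) b ∧ IndGen (w + 1) e ∧ f = b * e} := rfl

lemma subLevel_succ (w : ℕ) : subLevel (w + 1) = Submodule.span ℚ
    {g | SubGen (termLevel w) (subLevel w) g} := rfl

lemma mul_mem_termLevel_succ {w : ℕ} {b e : LTerm → ℚ}
    (hb : TermGen (termLevel w) (subLevel w) b) (he : IndGen (w + 1) e) :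
    b * e ∈ termLevel (w + 1) :=
  Submodule.subset_span ⟨b, e, hb, he, rfl⟩

lemma TermGen.mem {w : ℕ} {b : LTerm → ℚ} (hb : TermGen (termLevel w) (subLevel w) b) :
    b ∈ termLevel (w + 1) := by
  simpa using mul_mem_termLevel_succ hb .one

lemma SubGen.mem {w : ℕ} {g : LSub → ℚ} (hg : SubGen (termLevel w) (subLevel w) g) :
    g ∈ subLevel (w + 1) :=
  Submodule.subset_span hg

lemma evConst_const (c : ℚ) : EvConst fun _ => c := ⟨0, c, fun _ _ => rfl⟩

lemma EvConst.mul {p q : ℕ → ℚ} (hp : EvConst p) (hq : EvConst q) : EvConst (p * q) := by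
  obtain ⟨M, c, h⟩ := hp
  obtain ⟨N, d, h'⟩ := hq
  refine ⟨max M N, c * d, fun n hn => ?_⟩
  rw [Pi.mul_apply, h n (le_trans (le_max_left _ _) hn), h' n (le_trans (le_max_right _ _) hn)]

lemma EvConst.add {p q : ℕ → ℚ} (hp : EvConst p) (hq : EvConst q) : EvConst (p + q) := by
  obtain ⟨M, c, h⟩ := hp
  obtain ⟨N, d, h'⟩ := hq
  refine ⟨max M N, c + d, fun n hn => ?_⟩
  rw [Pi.add_apply, h n (le_trans (le_max_left _ _) hn), h' n (le_trans (le_max_right _ _) hn)]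

lemma EvConst.smul {p : ℕ → ℚ} (a : ℚ) (hp : EvConst p) : EvConst (a • p) := by
  obtain ⟨M, c, h⟩ := hp
  exact ⟨M, a * c, fun n hn => by simp [h n hn]⟩

lemma one_eq_sum_termFn :
    (1 : LTerm → ℚ) = idxFn 1 + lamFn 1 + appFn 1 1 + closFn 1 1 := by
  funext t
  cases t <;> simp [idxFn, lamFn, appFn, closFn]

lemma one_eq_sum_subFn : (1 : LSub → ℚ) = slashFn 1 + liftFn 1 + shiftFn := by
  funext s
  cases s <;> simp [slashFn, liftFn, shiftFn]

lemma one_mem_level (w : ℕ) : 1 ∈ termLevel w ∧ 1 ∈ subLevel w := by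
  induction w with
  | zero => exact ⟨Submodule.subset_span .one, Submodule.subset_span rfl⟩
  | succ w ih =>
    constructor
    · rw [one_eq_sum_termFn]
      exact add_mem (add_mem (add_mem (TermGen.idx (evConst_const 1)).mem (TermGen.lam ih.1).mem)
        (TermGen.app ih.1 ih.1).mem) (TermGen.clos ih.1 ih.2).mem
    · rw [one_eq_sum_subFn]
      exact add_mem (add_mem (SubGen.slash ih.1).mem (SubGen.lift ih.2).mem) SubGen.shift.mem

lemma one_mem_termLevel (w : ℕ) : 1 ∈ termLevel w := (one_mem_level w).1

lemma one_mem_subLevel (w : ℕ) : 1 ∈ subLevel w := (one_mem_level w).2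

lemma IndGen.mono {v w : ℕ} (h : v ≤ w) {e : LTerm → ℚ} (he : IndGen v e) : IndGen w e := by
  cases he with
  | one => exact .one
  | ind hi => exact .ind (hi.trans h)

lemma IndGen.mem {w : ℕ} {e : LTerm → ℚ} (he : IndGen w e) : e ∈ termLevel w := by
  cases w with
  | zero => exact Submodule.subset_span he
  | succ w =>
    rw [← one_mul e, one_eq_sum_termFn, add_mul, add_mul, add_mul]
    exact add_mem (add_mem (add_mem
      (mul_mem_termLevel_succ (TermGen.idx (evConst_const 1)) he)
      (mul_mem_termLevel_succ (TermGen.lam (one_mem_termLevel w)) he))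
      (mul_mem_termLevel_succ (TermGen.app (one_mem_termLevel w) (one_mem_termLevel w)) he))
      (mul_mem_termLevel_succ (TermGen.clos (one_mem_termLevel w) (one_mem_subLevel w)) he)

lemma TermGen.mono {A A' : Submodule ℚ (LTerm → ℚ)} {B B' : Submodule ℚ (LSub → ℚ)}
    (hA : A ≤ A') (hB : B ≤ B') {b : LTerm → ℚ} (h : TermGen A B b) : TermGen A' B' b := by
  cases h with
  | idx hp => exact .idx hp
  | lam hf => exact .lam (hA hf)
  | app hf hg => exact .app (hA hf) (hA hg)
  | clos hf hg => exact .clos (hA hf) (hB hg)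

lemma SubGen.mono {A A' : Submodule ℚ (LTerm → ℚ)} {B B' : Submodule ℚ (LSub → ℚ)}
    (hA : A ≤ A') (hB : B ≤ B') {b : LSub → ℚ} (h : SubGen A B b) : SubGen A' B' b := by
  cases h with
  | slash hf => exact .slash (hA hf)
  | lift hg => exact .lift (hB hg)
  | shift => exact .shift

lemma level_le_succ (w : ℕ) :
    termLevel w ≤ termLevel (w + 1) ∧ subLevel w ≤ subLevel (w + 1) := by
  induction w with
  | zero =>
    constructor
    · rw [termLevel_zero, Submodule.span_le]
      exact fun e he => IndGen.mem (IndGen.mono (Nat.zero_le 1) he)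
    · rw [subLevel_zero, Submodule.span_le, Set.singleton_subset_iff]
      exact one_mem_subLevel 1
  | succ w ih =>
    constructor
    · rw [termLevel_succ w, Submodule.span_le]
      rintro _ ⟨b, e, hb, he, rfl⟩
      exact mul_mem_termLevel_succ (hb.mono ih.1 ih.2) (he.mono (Nat.le_succ _))
    · rw [subLevel_succ w, Submodule.span_le]
      exact fun g hg => SubGen.mem (SubGen.mono ih.1 ih.2 hg)

lemma termLevel_mono : Monotone termLevel := monotone_nat_of_le_succ fun w => (level_le_succ w).1

lemma subLevel_mono : Monotone subLevel := monotone_nat_of_le_succ fun w => (level_le_succ w).2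

lemma ind_mem_termLevel {k w : ℕ} (h : 2 * k ≤ w) : ind k ∈ termLevel w := (IndGen.ind h).mem

lemma span_mul_mem {α : Type*} {s : Set (α → ℚ)}
    (h : ∀ x ∈ s, ∀ y ∈ s, x * y ∈ Submodule.span ℚ s) {x y : α → ℚ}
    (hx : x ∈ Submodule.span ℚ s) (hy : y ∈ Submodule.span ℚ s) :
    x * y ∈ Submodule.span ℚ s := by
  have h1 := Submodule.mul_mem_mul hx hy
  rw [Submodule.span_mul_span] at h1
  refine Submodule.span_le.mpr ?_ h1
  rintro _ ⟨a, ha, b, hb, rfl⟩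
  exact h a ha b hb

lemma IndGen.mul {w : ℕ} {e e' : LTerm → ℚ} (h : IndGen w e) (h' : IndGen w e') :
    IndGen w (e * e') ∨ e * e' = 0 := by
  cases h with
  | one => rw [one_mul]; exact .inl h'
  | @ind i hi =>
    cases h' with
    | one => rw [mul_one]; exact .inl (.ind hi)
    | @ind j hj =>
      rw [ind_mul_ind]
      split_ifs
      · exact .inl (.ind hi)
      · exact .inr rfl

lemma idxFn_mul (p q : ℕ → ℚ) : idxFn p * idxFn q = idxFn (p * q) := by
  funext t; cases t <;> simp [idxFn]

lemma lamFn_mul (f g : LTerm → ℚ) : lamFn f * lamFn g = lamFn (f * g) := by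
  funext t; cases t <;> simp [lamFn]

lemma appFn_mul (f g f' g' : LTerm → ℚ) :
    appFn f g * appFn f' g' = appFn (f * f') (g * g') := by
  funext t; cases t <;> simp [appFn]; ring

lemma closFn_mul (f f' : LTerm → ℚ) (g g' : LSub → ℚ) :
    closFn f g * closFn f' g' = closFn (f * f') (g * g') := by
  funext t; cases t <;> simp [closFn]; ring

lemma TermGen.mul {A : Submodule ℚ (LTerm → ℚ)} {B : Submodule ℚ (LSub → ℚ)}
    (hA : ∀ f ∈ A, ∀ g ∈ A, f * g ∈ A) (hB : ∀ f ∈ B, ∀ g ∈ B, f * g ∈ B)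
    {b b' : LTerm → ℚ} (h : TermGen A B b) (h' : TermGen A B b') :
    TermGen A B (b * b') ∨ b * b' = 0 := by
  cases h <;> cases h'
  case idx.idx hp _ hq => rw [idxFn_mul]; exact .inl (.idx (hp.mul hq))
  case lam.lam hf _ hg => rw [lamFn_mul]; exact .inl (.lam (hA _ hf _ hg))
  case app.app hf hg _ _ hf' hg' =>
    rw [appFn_mul]; exact .inl (.app (hA _ hf _ hf') (hA _ hg _ hg'))
  case clos.clos hf hg _ _ hf' hg' =>
    rw [closFn_mul]; exact .inl (.clos (hA _ hf _ hf') (hB _ hg _ hg'))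
  all_goals
    right
    funext t
    cases t <;> simp [idxFn, lamFn, appFn, closFn]

lemma SubGen.mul {A : Submodule ℚ (LTerm → ℚ)} {B : Submodule ℚ (LSub → ℚ)}
    (hA : ∀ f ∈ A, ∀ g ∈ A, f * g ∈ A) (hB : ∀ f ∈ B, ∀ g ∈ B, f * g ∈ B)
    {b b' : LSub → ℚ} (h : SubGen A B b) (h' : SubGen A B b') :
    SubGen A B (b * b') ∨ b * b' = 0 := by
  cases h <;> cases h'
  case slash.slash f hf g hg =>
    left
    convert SubGen.slash (B := B) (hA _ hf _ hg) using 1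
    funext s; cases s <;> simp [slashFn]
  case lift.lift f hf g hg =>
    left
    convert SubGen.lift (A := A) (hB _ hf _ hg) using 1
    funext s; cases s <;> simp [liftFn]
  case shift.shift =>
    left
    convert SubGen.shift (A := A) (B := B) using 1
    funext s; cases s <;> simp [shiftFn]
  all_goals
    right
    funext s
    cases s <;> simp [slashFn, liftFn, shiftFn]

lemma mul_mem_level (w : ℕ) :
    (∀ f ∈ termLevel w, ∀ g ∈ termLevel w, f * g ∈ termLevel w) ∧
      ∀ f ∈ subLevel w, ∀ g ∈ subLevel w, f * g ∈ subLevel w := by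
  induction w with
  | zero =>
    refine ⟨fun f hf g hg => span_mul_mem ?_ hf hg, fun f hf g hg => span_mul_mem ?_ hf hg⟩
    · intro x hx y hy
      rcases IndGen.mul hx hy with h | h
      · exact h.mem
      · rw [h]; exact zero_mem _
    · rintro _ rfl _ rfl
      rw [mul_one]; exact one_mem_subLevel 0
  | succ w ih =>
    refine ⟨fun f hf g hg => span_mul_mem ?_ hf hg, fun f hf g hg => span_mul_mem ?_ hf hg⟩
    · rintro _ ⟨b, e, hb, he, rfl⟩ _ ⟨b', e', hb', he', rfl⟩
      rw [mul_mul_mul_comm]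
      rcases IndGen.mul he he' with h | h
      · rcases TermGen.mul ih.1 ih.2 hb hb' with h' | h'
        · exact mul_mem_termLevel_succ h' h
        · rw [h', zero_mul]; exact zero_mem _
      · rw [h, mul_zero]; exact zero_mem _
    · intro x hx y hy
      rcases SubGen.mul ih.1 ih.2 hx hy with h | h
      · exact h.mem
      · rw [h]; exact zero_mem _

lemma mul_mem_termLevel {w : ℕ} {f g : LTerm → ℚ} (hf : f ∈ termLevel w) (hg : g ∈ termLevel w) :
    f * g ∈ termLevel w := (mul_mem_level w).1 f hf g hg

lemma mul_mem_subLevel {w : ℕ} {f g : LSub → ℚ} (hf : f ∈ subLevel w) (hg : g ∈ subLevel w) :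
    f * g ∈ subLevel w := (mul_mem_level w).2 f hf g hg

lemma comp_lift_mem_subLevel {w : ℕ} {g : LSub → ℚ} (hg : g ∈ subLevel w) :
    g ∘ LSub.lift ∈ subLevel w := by
  let T : (LSub → ℚ) →ₗ[ℚ] (LSub → ℚ) := LinearMap.funLeft ℚ ℚ LSub.lift
  suffices h : subLevel w ≤ (subLevel w).comap T from h hg
  cases w with
  | zero =>
    rw [subLevel_zero, Submodule.span_le, Set.singleton_subset_iff]
    exact one_mem_subLevel 0
  | succ w =>
    rw [subLevel_succ, Submodule.span_le]
    intro g hg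
    cases hg with
    | @lift g hg => exact (level_le_succ w).2 hg
    | slash _ => exact zero_mem (subLevel (w + 1))
    | shift => exact zero_mem (subLevel (w + 1))

lemma ind_idx (i n : ℕ) : ind i (.idx n) = if i = 0 then 1 else 0 := by
  have h0 : NormIn (.idx n) 0 := .base trivial
  split_ifs with h
  · subst h; simp [ind, h0]
  · exact if_neg fun h' => h (normIn_unique h' h0)

lemma IndGen.evConst {w : ℕ} {e : LTerm → ℚ} (he : IndGen w e) :
    EvConst fun n => e (.idx n) := by
  cases he with
  | one => exact evConst_const 1
  | ind _ => simp_rw [ind_idx]; exact evConst_const _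

lemma evConst_of_mem_termLevel {w : ℕ} {f : LTerm → ℚ} (hf : f ∈ termLevel w) :
    EvConst fun n => f (.idx n) := by
  let S : Submodule ℚ (LTerm → ℚ) :=
    { carrier := {f | EvConst fun n => f (.idx n)}
      add_mem' := EvConst.add
      zero_mem' := evConst_const 0
      smul_mem' := fun c _ h => h.smul c }
  suffices h : termLevel w ≤ S from h hf
  cases w with
  | zero =>
    rw [termLevel_zero, Submodule.span_le]
    exact fun e he => IndGen.evConst he
  | succ w =>
    rw [termLevel_succ, Submodule.span_le]
    rintro _ ⟨b, e, hb, he, rfl⟩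
    refine EvConst.mul ?_ he.evConst
    cases hb with
    | idx hp => exact hp
    | _ => exact evConst_const 0

end Spaces

section Tensors

/-- The function `(s₁, …, sₘ) ↦ g₁ s₁ * ⋯ * gₘ sₘ`, extended by zero to lists of other lengths. -/
def evalList : List (LSub → ℚ) → List LSub → ℚ
  | [], [] => 1
  | g :: gs, s :: v => g s * evalList gs v
  | _, _ => 0

/-- The function `(t, v) ↦ f t * evalList gs v`. -/
def pureTensor (f : LTerm → ℚ) (gs : List (LSub → ℚ)) : LTerm × List LSub → ℚ :=
  fun x => f x.1 * evalList gs x.2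

/-- The space spanned by the pure tensors of functions of complexity `w`. -/
def tensors (w : ℕ) : Submodule ℚ (LTerm × List LSub → ℚ) :=
  Submodule.span ℚ {F | ∃ f ∈ termLevel w, ∃ gs : List (LSub → ℚ),
    (∀ g ∈ gs, g ∈ subLevel w) ∧ F = pureTensor f gs}

lemma pureTensor_mem {w : ℕ} {f : LTerm → ℚ} (hf : f ∈ termLevel w) {gs : List (LSub → ℚ)}
    (hgs : ∀ g ∈ gs, g ∈ subLevel w) : pureTensor f gs ∈ tensors w :=
  Submodule.subset_span ⟨f, hf, gs, hgs, rfl⟩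

/-- Precomposition with a partial function, with value zero where it is undefined. -/
def pullback (ρ : LTerm × List LSub → Option (LTerm × List LSub)) :
    (LTerm × List LSub → ℚ) →ₗ[ℚ] (LTerm × List LSub → ℚ) where
  toFun F x := (ρ x).elim 0 F
  map_add' F G := by funext x; cases h : ρ x <;> simp [h]
  map_smul' c F := by funext x; cases h : ρ x <;> simp [h]

lemma map_mem_of_pureTensor {M : Type*} [AddCommGroup M] [Module ℚ M] {w : ℕ}
    {S : Submodule ℚ M} (T : (LTerm × List LSub → ℚ) →ₗ[ℚ] M)
    (h : ∀ f ∈ termLevel w, ∀ gs : List (LSub → ℚ), (∀ g ∈ gs, g ∈ subLevel w) →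
      T (pureTensor f gs) ∈ S)
    {F : LTerm × List LSub → ℚ} (hF : F ∈ tensors w) : T F ∈ S := by
  suffices h' : tensors w ≤ S.comap T from h' hF
  rw [tensors, Submodule.span_le]
  rintro _ ⟨f, hf, gs, hgs, rfl⟩
  exact h f hf gs hgs

/-- `(λa, v) ↦ (a, ⇑v)` -/
def lamMap : LTerm × List LSub → Option (LTerm × List LSub)
  | (.lam a, v) => some (a, v.map .lift)
  | _ => none

/-- `(a[s], v) ↦ (a, s :: v)` -/
def closMap : LTerm × List LSub → Option (LTerm × List LSub)
  | (.clos a s, v) => some (a, s :: v)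
  | _ => none

/-- `(0, a/ :: v) ↦ (a, v)` -/
def fvarMap : LTerm × List LSub → Option (LTerm × List LSub)
  | (.idx 0, .slash a :: v) => some (a, v)
  | _ => none

/-- `(S n, a/ :: v) ↦ (n, v)` -/
def rvarMap : LTerm × List LSub → Option (LTerm × List LSub)
  | (.idx (n + 1), .slash _ :: v) => some (.idx n, v)
  | _ => none

/-- `(0, ⇑(s) :: v) ↦ (0, v)` -/
def fvarLiftMap : LTerm × List LSub → Option (LTerm × List LSub)
  | (.idx 0, .lift _ :: v) => some (.idx 0, v)
  | _ => none

/-- `(S n, ⇑(s) :: v) ↦ (n, s :: ↑ :: v)` -/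
def rvarLiftMap : LTerm × List LSub → Option (LTerm × List LSub)
  | (.idx (n + 1), .lift s :: v) => some (.idx n, s :: .shift :: v)
  | _ => none

/-- `(n, ↑ :: v) ↦ (S n, v)` -/
def varShiftMap : LTerm × List LSub → Option (LTerm × List LSub)
  | (.idx n, .shift :: v) => some (.idx (n + 1), v)
  | _ => none

/-- `(a b, v) ↦ F (a, v) * G (b, v)`, extended by zero. -/
def appPair (F G : LTerm × List LSub → ℚ) : LTerm × List LSub → ℚ
  | (.app a b, v) => F (a, v) * G (b, v)
  | _ => 0

lemma evalList_map_lift (gs : List (LSub → ℚ)) (v : List LSub) :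
    evalList gs (v.map .lift) = evalList (gs.map (· ∘ LSub.lift)) v := by
  induction gs generalizing v with
  | nil => cases v <;> rfl
  | cons g gs ih =>
    cases v with
    | nil => rfl
    | cons s v => simp [evalList, ih]

lemma evalList_mul (gs hs : List (LSub → ℚ)) :
    (∀ v, evalList gs v * evalList hs v = 0) ∨
      ∀ v, evalList gs v * evalList hs v = evalList (List.zipWith (· * ·) gs hs) v := by
  induction gs generalizing hs with
  | nil =>
    cases hs with
    | nil => right; intro v; cases v <;> simp [evalList]
    | cons h hs => left; intro v; cases v <;> simp [evalList]
  | cons g gs ih =>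
    cases hs with
    | nil => left; intro v; cases v <;> simp [evalList]
    | cons h hs =>
      rcases ih hs with ih | ih
      · left; intro v
        cases v with
        | nil => simp [evalList]
        | cons s v => simp only [evalList]; rw [mul_mul_mul_comm, ih, mul_zero]
      · right; intro v
        cases v with
        | nil => simp [evalList]
        | cons s v =>
          simp only [evalList, List.zipWith_cons_cons, Pi.mul_apply]
          rw [mul_mul_mul_comm, ih]

lemma mem_zipWith_mul {w : ℕ} {gs hs : List (LSub → ℚ)} (hg : ∀ g ∈ gs, g ∈ subLevel w)
    (hh : ∀ h ∈ hs, h ∈ subLevel w) :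
    ∀ k ∈ List.zipWith (· * ·) gs hs, k ∈ subLevel w := by
  induction gs generalizing hs with
  | nil => simp
  | cons g gs ih =>
    cases hs with
    | nil => simp
    | cons h hs =>
      simp only [List.mem_cons, forall_eq_or_imp, List.zipWith_cons_cons] at hg hh ⊢
      exact ⟨mul_mem_subLevel hg.1 hh.1, ih hg.2 hh.2⟩

lemma evConst_single_zero (c : ℚ) : EvConst fun n => if n = 0 then c else 0 :=
  ⟨1, 0, fun n hn => if_neg (by omega)⟩

lemma EvConst.pred {p : ℕ → ℚ} (hp : EvConst p) :
    EvConst fun n => if n = 0 then 0 else p (n - 1) := by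
  obtain ⟨M, c, h⟩ := hp
  exact ⟨M + 1, c, fun n hn => (if_neg (by omega)).trans (h _ (by omega))⟩

lemma EvConst.succ {p : ℕ → ℚ} (hp : EvConst p) : EvConst fun n => p (n + 1) := by
  obtain ⟨M, c, h⟩ := hp
  exact ⟨M, c, fun n hn => h _ (by omega)⟩

variable {w : ℕ} {F G : LTerm × List LSub → ℚ}

lemma lamMap_mem (hF : F ∈ tensors w) : pullback lamMap F ∈ tensors (w + 1) := by
  refine map_mem_of_pureTensor _ (fun f hf gs hgs => ?_) hF
  have e : pullback lamMap (pureTensor f gs) =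
      pureTensor (lamFn f) (gs.map (· ∘ LSub.lift)) := by
    funext ⟨t, v⟩
    cases t <;> simp [pullback, lamMap, pureTensor, lamFn, evalList_map_lift]
  rw [e]
  refine pureTensor_mem (TermGen.lam hf).mem ?_
  simp only [List.mem_map, forall_exists_index, and_imp, forall_apply_eq_imp_iff₂]
  exact fun g hg => (level_le_succ w).2 (comp_lift_mem_subLevel (hgs g hg))

lemma closMap_mem (hF : F ∈ tensors w) : pullback closMap F ∈ tensors (w + 1) := by
  refine map_mem_of_pureTensor _ (fun f hf gs hgs => ?_) hF
  cases gs with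
  | nil =>
    convert zero_mem (tensors (w + 1)) using 1
    funext ⟨t, v⟩
    cases t <;> simp [pullback, closMap, pureTensor, evalList]
  | cons g gs =>
    simp only [List.mem_cons, forall_eq_or_imp] at hgs
    have e : pullback closMap (pureTensor f (g :: gs)) = pureTensor (closFn f g) gs := by
      funext ⟨t, v⟩
      cases t <;> simp [pullback, closMap, pureTensor, evalList, closFn, mul_assoc]
    rw [e]
    exact pureTensor_mem (TermGen.clos hf hgs.1).mem fun g hg => (level_le_succ w).2 (hgs.2 g hg)

lemma cons_mem {g : LSub → ℚ} {gs : List (LSub → ℚ)} (hg : g ∈ subLevel (w + 1))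
    (hgs : ∀ g ∈ gs, g ∈ subLevel w) : ∀ h ∈ g :: gs, h ∈ subLevel (w + 1) := by
  simp only [List.mem_cons, forall_eq_or_imp]
  exact ⟨hg, fun h hh => (level_le_succ w).2 (hgs h hh)⟩

lemma fvarMap_mem (hF : F ∈ tensors w) : pullback fvarMap F ∈ tensors (w + 1) := by
  refine map_mem_of_pureTensor _ (fun f hf gs hgs => ?_) hF
  have e : pullback fvarMap (pureTensor f gs) =
      pureTensor (idxFn fun n => if n = 0 then 1 else 0) (slashFn f :: gs) := by
    funext ⟨t, v⟩
    rcases t with (_ | n) | _ | _ | _ <;> rcases v with _ | ⟨_ | _ | _, v⟩ <;>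
      simp [pullback, fvarMap, pureTensor, evalList, idxFn, slashFn]
  rw [e]
  exact pureTensor_mem (TermGen.idx (evConst_single_zero 1)).mem
    (cons_mem (SubGen.slash hf).mem hgs)

lemma rvarMap_mem (hF : F ∈ tensors w) : pullback rvarMap F ∈ tensors (w + 1) := by
  refine map_mem_of_pureTensor _ (fun f hf gs hgs => ?_) hF
  have e : pullback rvarMap (pureTensor f gs) =
      pureTensor (idxFn fun n => if n = 0 then 0 else f (.idx (n - 1))) (slashFn 1 :: gs) := by
    funext ⟨t, v⟩
    rcases t with (_ | n) | _ | _ | _ <;> rcases v with _ | ⟨_ | _ | _, v⟩ <;>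
      simp [pullback, rvarMap, pureTensor, evalList, idxFn, slashFn]
  rw [e]
  exact pureTensor_mem (TermGen.idx (evConst_of_mem_termLevel hf).pred).mem
    (cons_mem (SubGen.slash (one_mem_termLevel w)).mem hgs)

lemma fvarLiftMap_mem (hF : F ∈ tensors w) : pullback fvarLiftMap F ∈ tensors (w + 1) := by
  refine map_mem_of_pureTensor _ (fun f hf gs hgs => ?_) hF
  have e : pullback fvarLiftMap (pureTensor f gs) =
      pureTensor (idxFn fun n => if n = 0 then f (.idx 0) else 0) (liftFn 1 :: gs) := by
    funext ⟨t, v⟩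
    rcases t with (_ | n) | _ | _ | _ <;> rcases v with _ | ⟨_ | _ | _, v⟩ <;>
      simp [pullback, fvarLiftMap, pureTensor, evalList, idxFn, liftFn]
  rw [e]
  exact pureTensor_mem (TermGen.idx (evConst_single_zero _)).mem
    (cons_mem (SubGen.lift (one_mem_subLevel w)).mem hgs)

lemma varShiftMap_mem (hF : F ∈ tensors w) : pullback varShiftMap F ∈ tensors (w + 1) := by
  refine map_mem_of_pureTensor _ (fun f hf gs hgs => ?_) hF
  have e : pullback varShiftMap (pureTensor f gs) =
      pureTensor (idxFn fun n => f (.idx (n + 1))) (shiftFn :: gs) := by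
    funext ⟨t, v⟩
    rcases t with _ | _ | _ | _ <;> rcases v with _ | ⟨_ | _ | _, v⟩ <;>
      simp [pullback, varShiftMap, pureTensor, evalList, idxFn, shiftFn]
  rw [e]
  exact pureTensor_mem (TermGen.idx (evConst_of_mem_termLevel hf).succ).mem
    (cons_mem SubGen.shift.mem hgs)

lemma rvarLiftMap_mem (hF : F ∈ tensors w) : pullback rvarLiftMap F ∈ tensors (w + 1) := by
  refine map_mem_of_pureTensor _ (fun f hf gs hgs => ?_) hF
  rcases gs with _ | ⟨g, _ | ⟨h, gs⟩⟩
  · convert zero_mem (tensors (w + 1)) using 1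
    funext ⟨t, v⟩
    rcases t with (_ | n) | _ | _ | _ <;> rcases v with _ | ⟨_ | _ | _, v⟩ <;>
      simp [pullback, rvarLiftMap, pureTensor, evalList]
  · convert zero_mem (tensors (w + 1)) using 1
    funext ⟨t, v⟩
    rcases t with (_ | n) | _ | _ | _ <;> rcases v with _ | ⟨_ | _ | _, v⟩ <;>
      simp [pullback, rvarLiftMap, pureTensor, evalList]
  · simp only [List.mem_cons, forall_eq_or_imp] at hgs
    have e : pullback rvarLiftMap (pureTensor f (g :: h :: gs)) = h .shift •
        pureTensor (idxFn fun n => if n = 0 then 0 else f (.idx (n - 1))) (liftFn g :: gs) := by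
      funext ⟨t, v⟩
      rcases t with (_ | n) | _ | _ | _ <;> rcases v with _ | ⟨_ | _ | _, v⟩ <;>
        simp [pullback, rvarLiftMap, pureTensor, evalList, idxFn, liftFn]
      ring
    rw [e]
    exact Submodule.smul_mem _ _ (pureTensor_mem
      (TermGen.idx (evConst_of_mem_termLevel hf).pred).mem
        (cons_mem (SubGen.lift hgs.1).mem hgs.2.2))

lemma appPair_mem (hF : F ∈ tensors w) (hG : G ∈ tensors w) :
    appPair F G ∈ tensors (w + 1) := by
  let B : (LTerm × List LSub → ℚ) →ₗ[ℚ] (LTerm × List LSub → ℚ) →ₗ[ℚ]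
      (LTerm × List LSub → ℚ) := LinearMap.mk₂ ℚ appPair
    (fun F F' G => by funext ⟨t, v⟩; cases t <;> simp [appPair, add_mul])
    (fun c F G => by funext ⟨t, v⟩; cases t <;> simp [appPair, mul_assoc])
    (fun F G G' => by funext ⟨t, v⟩; cases t <;> simp [appPair, mul_add])
    (fun c F G => by funext ⟨t, v⟩; cases t <;> simp [appPair]; ring)
  refine map_mem_of_pureTensor (B.flip G) (fun f hf gs hgs => ?_) hF
  refine map_mem_of_pureTensor (B (pureTensor f gs)) (fun f' hf' gs' hgs' => ?_) hG
  change appPair (pureTensor f gs) (pureTensor f' gs') ∈ _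
  rcases evalList_mul gs gs' with h | h
  · convert zero_mem (tensors (w + 1)) using 1
    funext ⟨t, v⟩
    cases t <;> simp only [appPair, pureTensor, Pi.zero_apply]
    rw [mul_mul_mul_comm, h, mul_zero]
  · have e : appPair (pureTensor f gs) (pureTensor f' gs') =
        pureTensor (appFn f f') (List.zipWith (· * ·) gs gs') := by
      funext ⟨t, v⟩
      cases t <;> simp only [appPair, pureTensor, appFn, zero_mul]
      rw [mul_mul_mul_comm, h]
    rw [e]
    exact pureTensor_mem (TermGen.app hf hf').mem
      fun k hk => (level_le_succ w).2 (mem_zipWith_mul hgs hgs' k hk)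

open Classical in
/-- The indicator function of `t[s₁]…[sₘ]` normalising in `k` steps. -/
noncomputable def chainInd (k m : ℕ) : LTerm × List LSub → ℚ :=
  fun x => if x.2.length = m ∧ NormIn (chain x.1 x.2) k then 1 else 0

open Classical in
lemma chainInd_zero (k : ℕ) : chainInd k 0 = pureTensor (ind k) [] := by
  funext ⟨t, v⟩
  cases v with
  | nil =>
    simp only [chainInd, pureTensor, evalList, ind, mul_one, chain_nil]
    exact if_congr (by simp) rfl rfl
  | cons s v => simp [chainInd, pureTensor, evalList]

lemma chainInd_eq_zero {k m : ℕ} (h : k < m) : chainInd k m = 0 := by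
  funext ⟨t, v⟩
  refine if_neg ?_
  rintro ⟨rfl, h'⟩
  exact absurd (length_le_of_normIn_chain h') (not_le.mpr h)

lemma sum_antidiagonal_ite {k : ℕ} {P Q : ℕ → Prop} [DecidablePred P] [DecidablePred Q]
    [Decidable (∃ p ∈ HasAntidiagonal.antidiagonal k, P p.1 ∧ Q p.2)]
    (hP : ∀ i j, P i → P j → i = j) :
    (∑ p ∈ HasAntidiagonal.antidiagonal k,
      (if P p.1 then 1 else 0) * (if Q p.2 then 1 else 0) : ℚ) =
      if ∃ p ∈ HasAntidiagonal.antidiagonal k, P p.1 ∧ Q p.2 then 1 else 0 := by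
  split_ifs with h
  · obtain ⟨p, hp, h1, h2⟩ := h
    rw [Finset.sum_eq_single p]
    · simp [h1, h2]
    · intro q hq hne
      rw [if_neg, zero_mul]
      intro h3
      apply hne
      have := hP _ _ h3 h1
      simp only [HasAntidiagonal.mem_antidiagonal] at hp hq
      ext <;> omega
    · exact fun h => absurd hp h
  · refine Finset.sum_eq_zero fun p hp => ?_
    by_cases h1 : P p.1
    · have : ¬ Q p.2 := fun h2 => h ⟨p, hp, h1, h2⟩
      simp [this]
    · simp [h1]

lemma chainInd_succ (d m : ℕ) : chainInd (d + (m + 1)) (m + 1) =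
    pullback lamMap (chainInd d (m + 1)) +
    pullback closMap (chainInd (d + (m + 1)) (m + 2)) +
    (∑ p ∈ HasAntidiagonal.antidiagonal d,
      appPair (chainInd p.1 (m + 1)) (chainInd p.2 (m + 1))) +
    pullback fvarMap (chainInd (d + m) m) +
    pullback rvarMap (chainInd (d + m) m) +
    pullback fvarLiftMap (chainInd (d + m) m) +
    pullback rvarLiftMap (chainInd (d + m) (m + 2)) +
    pullback varShiftMap (chainInd (d + m) m) := by
  classical
  funext ⟨t, v⟩
  have hzero : ∀ t, (∀ a b, t ≠ .app a b) → ∀ v,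
      ∑ p ∈ HasAntidiagonal.antidiagonal d,
        appPair (chainInd p.1 (m + 1)) (chainInd p.2 (m + 1)) (t, v) = 0 := by
    intro t ht v
    refine Finset.sum_eq_zero fun p _ => ?_
    cases t <;> simp_all [appPair]
  cases t with
  | lam a =>
    simp only [Pi.add_apply, Finset.sum_apply, hzero (.lam a) (by simp)]
    simp only [pullback, lamMap, closMap, fvarMap, rvarMap, fvarLiftMap, rvarLiftMap, varShiftMap,
      LinearMap.coe_mk, AddHom.coe_mk, Option.elim, add_zero]
    simp only [chainInd, List.length_map]
    refine if_congr (and_congr_right fun h => ?_) rfl rfl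
    rw [← h, normIn_chain_lam]
  | clos a s =>
    simp only [Pi.add_apply, Finset.sum_apply, hzero (.clos a s) (by simp)]
    simp only [pullback, lamMap, closMap, fvarMap, rvarMap, fvarLiftMap, rvarLiftMap, varShiftMap,
      LinearMap.coe_mk, AddHom.coe_mk, Option.elim, add_zero, zero_add]
    simp [chainInd]
  | app a b =>
    simp only [Pi.add_apply, Finset.sum_apply]
    simp only [pullback, lamMap, closMap, fvarMap, rvarMap, fvarLiftMap, rvarLiftMap, varShiftMap,
      LinearMap.coe_mk, AddHom.coe_mk, Option.elim, add_zero, zero_add, appPair]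
    by_cases h : v.length = m + 1
    · simp only [chainInd, h, true_and]
      rw [sum_antidiagonal_ite fun i j hi hj => normIn_unique hi hj]
      refine if_congr ?_ rfl rfl
      rw [← h, normIn_chain_app]
    · simp [chainInd, h]
  | idx n =>
    simp only [Pi.add_apply, Finset.sum_apply, hzero (.idx n) (by simp)]
    rcases v with _ | ⟨_ | _ | _, v⟩
    · simp only [pullback, lamMap, closMap, fvarMap, rvarMap, fvarLiftMap, rvarLiftMap,
        varShiftMap, LinearMap.coe_mk, AddHom.coe_mk, Option.elim, add_zero]
      simp [chainInd]
    all_goals rcases n with _ | n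
    all_goals
      simp only [pullback, lamMap, closMap, fvarMap, rvarMap, fvarLiftMap, rvarLiftMap,
        varShiftMap, LinearMap.coe_mk, AddHom.coe_mk, Option.elim, add_zero, zero_add]
      simp only [chainInd, List.length_cons, Nat.add_right_cancel_iff]
      refine if_congr (and_congr (by simp) ?_) rfl rfl
      rw [chain_cons, ← add_assoc]
    · exact normIn_chain_succ (.fvar _) v _
    · exact normIn_chain_succ (.rvar _ _) v _
    · exact normIn_chain_succ (.fvarLift _) v _
    · exact normIn_chain_succ (.rvarLift _ _) v _
    · exact normIn_chain_succ (.varShift _) v _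
    · exact normIn_chain_succ (.varShift _) v _

lemma chainInd_mem (w : ℕ) : ∀ k m, 2 * k ≤ w + m → chainInd k m ∈ tensors w := by
  have base : ∀ w k, 2 * k ≤ w → chainInd k 0 ∈ tensors w := fun w k h => by
    rw [chainInd_zero]
    exact pureTensor_mem (ind_mem_termLevel h) (by simp)
  induction w with
  | zero =>
    intro k m h
    rcases lt_or_ge k m with hlt | hge
    · rw [chainInd_eq_zero hlt]; exact zero_mem _
    · obtain rfl : m = 0 := by omega
      exact base 0 k (by omega)
  | succ w ih =>
    intro k m h
    cases m with
    | zero => exact base _ k (by omega)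
    | succ m =>
      rcases lt_or_ge k (m + 1) with hlt | hge
      · rw [chainInd_eq_zero hlt]; exact zero_mem _
      · obtain ⟨d, rfl⟩ := Nat.exists_eq_add_of_le' hge
        rw [chainInd_succ]
        refine add_mem (add_mem (add_mem (add_mem (add_mem (add_mem (add_mem ?_ ?_) ?_) ?_) ?_) ?_)
          ?_) ?_
        · exact lamMap_mem (ih _ _ (by omega))
        · exact closMap_mem (ih _ _ (by omega))
        · refine sum_mem fun p hp => ?_
          rw [HasAntidiagonal.mem_antidiagonal] at hp
          exact appPair_mem (ih _ _ (by omega)) (ih _ _ (by omega))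
        · exact fvarMap_mem (ih _ _ (by omega))
        · exact rvarMap_mem (ih _ _ (by omega))
        · exact fvarLiftMap_mem (ih _ _ (by omega))
        · exact rvarLiftMap_mem (ih _ _ (by omega))
        · exact varShiftMap_mem (ih _ _ (by omega))

end Tensors

section GeneratingFunctions

/-- Types with a size such that there are finitely many elements of each size. -/
class FinSized (α : Type) where
  /-- The size of an element. -/
  size : α → ℕ
  finite : ∀ n, {a | size a = n}.Finite

lemma finite_size_le (n : ℕ) :
    {t : LTerm | t.size ≤ n}.Finite ∧ {s : LSub | s.size ≤ n}.Finite := by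
  induction n with
  | zero =>
    constructor
    · refine Set.finite_empty.subset fun t ht => ?_
      cases t <;> simp [LTerm.size] at ht
    · refine Set.finite_empty.subset fun s hs => ?_
      cases s <;> simp [LSub.size] at hs
  | succ n ih =>
    obtain ⟨ht, hs⟩ := ih
    constructor
    · refine ((((Set.finite_Iic n).image LTerm.idx).union (ht.image LTerm.lam)).union
        ((ht.image2 LTerm.app ht).union (ht.image2 LTerm.clos hs))).subset fun t h => ?_
      cases t with
      | idx m => exact .inl (.inl ⟨m, by simpa [LTerm.size] using h, rfl⟩)
      | lam a => exact .inl (.inr ⟨a, by simp [LTerm.size] at h ⊢; omega, rfl⟩)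
      | app a b =>
        simp only [LTerm.size, Set.mem_ofPred_eq] at h
        exact .inr (.inl ⟨a, by simp; omega, b, by simp; omega, rfl⟩)
      | clos a s =>
        simp only [LTerm.size, Set.mem_ofPred_eq] at h
        exact .inr (.inr ⟨a, by simp; omega, s, by simp; omega, rfl⟩)
    · refine (((ht.image LSub.slash).union (hs.image LSub.lift)).union
        (Set.finite_singleton LSub.shift)).subset fun s h => ?_
      cases s with
      | slash a => exact .inl (.inl ⟨a, by simp [LSub.size] at h ⊢; omega, rfl⟩)
      | lift s => exact .inl (.inr ⟨s, by simp [LSub.size] at h ⊢; omega, rfl⟩)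
      | shift => exact .inr rfl

instance : FinSized LTerm :=
  ⟨LTerm.size, fun n => (finite_size_le n).1.subset fun _ h => le_of_eq h⟩

instance : FinSized LSub :=
  ⟨LSub.size, fun n => (finite_size_le n).2.subset fun _ h => le_of_eq h⟩

variable {α β γ : Type} [FinSized α] [FinSized β] [FinSized γ]

/-- The elements of size `n`. -/
noncomputable def ofSize (α : Type) [FinSized α] (n : ℕ) : Finset α := (FinSized.finite n).toFinset

lemma mem_ofSize {a : α} {n : ℕ} : a ∈ ofSize α n ↔ FinSized.size a = n := by simp [ofSize]

/-- The generating function of the elements of `α`, weighted by `f`. -/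
noncomputable def gf : (α → ℚ) →ₗ[ℚ] ℝ⟦X⟧ where
  toFun f := PowerSeries.mk fun n => ∑ a ∈ ofSize α n, (f a : ℝ)
  map_add' f g := by ext n; simp [Finset.sum_add_distrib]
  map_smul' c f := by ext n; simp [Finset.mul_sum, Rat.smul_def]

lemma coeff_gf (f : α → ℚ) (n : ℕ) : coeff n (gf f) = ∑ a ∈ ofSize α n, (f a : ℝ) := by
  simp [gf]

lemma coeff_gf_nonneg {f : α → ℚ} (h : ∀ a, 0 ≤ f a) (n : ℕ) : 0 ≤ coeff n (gf f) := by
  rw [coeff_gf]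
  exact Finset.sum_nonneg fun a _ => by exact_mod_cast h a

lemma gf_eq_X_mul_mul {c : α → β → γ} (hc : Function.Injective2 c)
    (hs : ∀ a b, FinSized.size (c a b) = 1 + FinSized.size a + FinSized.size b)
    {F : γ → ℚ} {f : α → ℚ} {g : β → ℚ} (hF : ∀ a b, F (c a b) = f a * g b)
    (h0 : ∀ x, (∀ a b, x ≠ c a b) → F x = 0) : gf F = X * (gf f * gf g) := by
  have hz : ∀ x, F x ≠ 0 → ∃ a b, c a b = x := fun x hx => by
    by_contra! h
    exact hx (h0 x fun a b e => h a b e.symm)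
  ext n
  cases n with
  | zero =>
    rw [coeff_zero_X_mul, coeff_gf]
    refine Finset.sum_eq_zero fun x hx => ?_
    rw [h0 x, Rat.cast_zero]
    rintro a b rfl
    rw [mem_ofSize, hs] at hx
    omega
  | succ n =>
    simp_rw [coeff_succ_X_mul, coeff_mul, coeff_gf, Finset.sum_mul_sum, ← Finset.sum_product']
    rw [Finset.sum_sigma']
    symm
    refine Finset.sum_of_injOn (fun x => c x.2.1 x.2.2) ?_ ?_ ?_ ?_
    · rintro ⟨p, a, b⟩ h ⟨q, a', b'⟩ h' e
      obtain ⟨rfl, rfl⟩ := hc e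
      simp only [coe_sigma, Set.mem_sigma_iff, Finset.mem_coe, mem_product, mem_ofSize] at h h'
      obtain rfl : p = q := Prod.ext (h.2.1.symm.trans h'.2.1) (h.2.2.symm.trans h'.2.2)
      rfl
    · rintro ⟨p, a, b⟩ h
      simp only [coe_sigma, Set.mem_sigma_iff, Finset.mem_coe, mem_product, mem_ofSize,
        HasAntidiagonal.mem_antidiagonal] at h ⊢
      rw [hs]; omega
    · intro x hx hx'
      by_contra hne
      obtain ⟨a, b, rfl⟩ := hz x fun h => hne (by rw [h, Rat.cast_zero])
      refine hx' ⟨⟨(FinSized.size a, FinSized.size b), a, b⟩, ?_, rfl⟩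
      rw [mem_ofSize, hs] at hx
      simp only [coe_sigma, Set.mem_sigma_iff, Finset.mem_coe, mem_product, mem_ofSize,
        HasAntidiagonal.mem_antidiagonal, and_self, and_true]
      omega
    · rintro ⟨p, a, b⟩ -
      rw [hF, Rat.cast_mul]

lemma gf_eq_X_mul {c : α → γ} (hc : Function.Injective c)
    (hs : ∀ a, FinSized.size (c a) = 1 + FinSized.size a)
    {F : γ → ℚ} {f : α → ℚ} (hF : ∀ a, F (c a) = f a)
    (h0 : ∀ x, (∀ a, x ≠ c a) → F x = 0) : gf F = X * gf f := by
  ext n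
  cases n with
  | zero =>
    rw [coeff_zero_X_mul, coeff_gf]
    refine Finset.sum_eq_zero fun x hx => ?_
    rw [h0 x, Rat.cast_zero]
    rintro a rfl
    rw [mem_ofSize, hs] at hx
    omega
  | succ n =>
    simp_rw [coeff_succ_X_mul, coeff_gf]
    symm
    refine Finset.sum_of_injOn c hc.injOn ?_ ?_ ?_
    · intro a h
      simp only [Finset.mem_coe, mem_ofSize] at h ⊢
      rw [hs]; omega
    · intro x hx hx'
      rw [h0 x, Rat.cast_zero]
      rintro a rfl
      refine hx' ⟨a, ?_, rfl⟩
      rw [mem_ofSize, hs] at hx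
      simp only [Finset.mem_coe, mem_ofSize]
      omega
    · intro a _
      rw [hF]

lemma gf_lamFn (f : LTerm → ℚ) : gf (lamFn f) = X * gf f :=
  gf_eq_X_mul (c := LTerm.lam) (fun _ _ h => LTerm.lam.inj h)
    (fun a => by simp [FinSized.size, LTerm.size])
    (fun _ => rfl) fun x hx => by
      cases x with
      | lam a => exact absurd rfl (hx a)
      | _ => rfl

lemma gf_slashFn (f : LTerm → ℚ) : gf (slashFn f) = X * gf f :=
  gf_eq_X_mul (c := LSub.slash) (fun _ _ h => LSub.slash.inj h)
    (fun a => by simp [FinSized.size, LSub.size])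
    (fun _ => rfl) fun x hx => by
      cases x with
      | slash a => exact absurd rfl (hx a)
      | _ => rfl

lemma gf_liftFn (g : LSub → ℚ) : gf (liftFn g) = X * gf g :=
  gf_eq_X_mul (c := LSub.lift) (fun _ _ h => LSub.lift.inj h)
    (fun a => by simp [FinSized.size, LSub.size])
    (fun _ => rfl) fun x hx => by
      cases x with
      | lift a => exact absurd rfl (hx a)
      | _ => rfl

lemma gf_appFn (f g : LTerm → ℚ) : gf (appFn f g) = X * (gf f * gf g) :=
  gf_eq_X_mul_mul (c := LTerm.app) (fun _ _ _ _ h => LTerm.app.inj h)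
    (fun a b => by simp [FinSized.size, LTerm.size])
    (fun _ _ => rfl) fun x hx => by
      cases x with
      | app a b => exact absurd rfl (hx a b)
      | _ => rfl

lemma gf_closFn (f : LTerm → ℚ) (g : LSub → ℚ) : gf (closFn f g) = X * (gf f * gf g) :=
  gf_eq_X_mul_mul (c := LTerm.clos) (fun _ _ _ _ h => LTerm.clos.inj h)
    (fun a b => by simp [FinSized.size, LTerm.size])
    (fun _ _ => rfl) fun x hx => by
      cases x with
      | clos a s => exact absurd rfl (hx a s)
      | _ => rfl

lemma gf_shiftFn : gf shiftFn = X := by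
  ext n
  rw [coeff_gf, coeff_X]
  split_ifs with h
  · subst h
    rw [Finset.sum_eq_single LSub.shift]
    · simp [shiftFn]
    · intro s _ hs
      cases s <;> simp_all [shiftFn]
    · intro h
      exact absurd (mem_ofSize.mpr rfl) h
  · refine Finset.sum_eq_zero fun s hs => ?_
    cases s with
    | shift => exact absurd (mem_ofSize.mp hs).symm h
    | _ => simp [shiftFn]

lemma gf_idxFn (p : ℕ → ℚ) : gf (idxFn p) = X * PowerSeries.mk fun n => (p n : ℝ) := by
  ext n
  rw [coeff_gf]
  cases n with
  | zero =>
    rw [coeff_zero_X_mul]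
    refine Finset.sum_eq_zero fun t ht => ?_
    cases t with
    | idx m => exact absurd (mem_ofSize.mp ht) (Nat.succ_ne_zero m)
    | _ => simp [idxFn]
  | succ n =>
    rw [coeff_succ_X_mul, coeff_mk, Finset.sum_eq_single (LTerm.idx n)]
    · rfl
    · intro t ht hne
      cases t with
      | idx m =>
        obtain rfl : m = n := Nat.succ.inj (mem_ofSize.mp ht)
        exact absurd rfl hne
      | _ => simp [idxFn]
    · intro h
      exact absurd (mem_ofSize.mpr rfl) h

lemma AlgCatalan.mk_evConst {p : ℕ → ℚ} (hp : EvConst p) :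
    AlgCatalan (PowerSeries.mk fun n => (p n : ℝ)) := by
  obtain ⟨M, c, h⟩ := hp
  have e : (PowerSeries.mk fun n => (p n : ℝ)) =
      c • LambdaUpsilon.geom + ∑ i ∈ range M, (p i - c) • (PowerSeries.X : ℝ⟦X⟧) ^ i := by
    ext n
    simp only [coeff_mk, map_add, map_sum, coeff_smul, LambdaUpsilon.geom, coeff_X_pow, smul_ite,
      smul_zero, Finset.sum_ite_eq, Finset.mem_range]
    split_ifs with hn
    · simp [Rat.smul_def]
    · simp [Rat.smul_def, h n (not_lt.mp hn)]
  have hX : ∀ i, AlgCatalan ((PowerSeries.X : ℝ⟦X⟧) ^ i) := fun i => by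
    induction i with
    | zero => rw [pow_zero]; exact AlgCatalan.one
    | succ i ih => rw [pow_succ]; exact ih.mul AlgCatalan.X
  rw [e]
  exact (AlgCatalan.geom.smul c).add
    (mem_algCatalan.mp (Submodule.sum_mem _ fun i _ => (hX i).smul _))

lemma AlgCatalan.gf_idxFn {p : ℕ → ℚ} (hp : EvConst p) : AlgCatalan (gf (idxFn p)) := by
  rw [LambdaUpsilon.gf_idxFn]
  exact AlgCatalan.X.mul (AlgCatalan.mk_evConst hp)

end GeneratingFunctions

section Systems

lemma summable_scaled_add {a b : ℝ⟦X⟧} (ha : Summable fun n => |scaled a n|)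
    (hb : Summable fun n => |scaled b n|) : Summable fun n => |scaled (a + b) n| := by
  refine Summable.of_nonneg_of_le (fun _ => abs_nonneg _) (fun n => ?_) (ha.add hb)
  rw [scaled_add]; exact abs_add_le _ _

lemma tsum_scaled_geom : ∑' n, scaled geom n = 4 / 3 := by
  simp only [scaled, geom, coeff_mk, one_mul]
  rw [tsum_geometric_of_lt_one (by norm_num) (by norm_num)]
  norm_num

lemma gf_idxFn_one : gf (idxFn 1) = X * geom := by
  rw [gf_idxFn]
  simp [geom]

/-- The generating function of all terms. -/
noncomputable def termSeries : ℝ⟦X⟧ := gf (1 : LTerm → ℚ)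

/-- The generating function of all substitutions. -/
noncomputable def subSeries : ℝ⟦X⟧ := gf (1 : LSub → ℚ)

lemma termSeries_eq_add : termSeries = X * geom + X * termSeries +
    X * (termSeries * termSeries) + X * (termSeries * subSeries) := by
  conv_lhs => rw [termSeries, one_eq_sum_termFn]
  rw [map_add, map_add, map_add, gf_idxFn_one, gf_lamFn, gf_appFn, gf_closFn]
  rfl

lemma subSeries_eq_add : subSeries = X * termSeries + X * subSeries + X := by
  conv_lhs => rw [subSeries, one_eq_sum_subFn]
  rw [map_add, map_add, gf_slashFn, gf_liftFn, gf_shiftFn]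
  rfl

lemma subSeries_eq : subSeries = geom * (X * (1 + termSeries)) := by
  linear_combination geom * subSeries_eq_add - subSeries * geom_eq

lemma one_add_termSeries : 1 + termSeries = 1 + X * ((1 + termSeries) * (1 + termSeries)) := by
  linear_combination (1 - X) * termSeries_eq_add + X * geom_eq + X * termSeries * subSeries_eq_add

lemma coeff_one_add_termSeries (n : ℕ) : coeff n (1 + termSeries) = (catalan n : ℝ) := by
  induction n using Nat.strong_induction_on with
  | _ n ih =>
    rw [one_add_termSeries, map_add]
    cases n with
    | zero => simp [coeff_zero_X_mul]
    | succ n =>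
      rw [coeff_succ_X_mul, coeff_mul, catalan_succ', coeff_one, if_neg (Nat.succ_ne_zero n),
        zero_add, Nat.cast_sum]
      refine Finset.sum_congr rfl fun p hp => ?_
      have := HasAntidiagonal.mem_antidiagonal.mp hp
      rw [ih _ (by omega), ih _ (by omega), Nat.cast_mul]

lemma scaled_one_add_termSeries (n : ℕ) : scaled (1 + termSeries) n = catScaled n := by
  rw [scaled, coeff_one_add_termSeries, catScaled]

lemma algCatalan_one_add_termSeries : AlgCatalan (1 + termSeries) := by
  have h0 : ∀ n, 0 ≤ coeff n (1 + termSeries) := fun n => by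
    rw [coeff_one_add_termSeries]; positivity
  have hsum : ∀ n, ∑ i ∈ range n, coeff i (1 + termSeries) * (1 / 4) ^ i ≤ (2 : ℝ) := fun n => by
    induction n with
    | zero => simp
    | succ n ih =>
      have h1 := sum_coeff_mul_le h0 h0 (r := 1 / 4) (by norm_num) n
      have hn : 0 ≤ ∑ i ∈ range n, coeff i (1 + termSeries) * (1 / 4) ^ i :=
        Finset.sum_nonneg fun i _ => mul_nonneg (h0 i) (by positivity)
      rw [one_add_termSeries]
      simp only [map_add (coeff _) 1, add_mul (coeff _ 1), Finset.sum_add_distrib]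
      rw [sum_coeff_X_mul, Finset.sum_eq_single 0]
      · simp only [coeff_zero_one, pow_zero]
        nlinarith
      · intro i _ hi
        rw [coeff_one, if_neg hi, zero_mul]
      · simp
  have hs := summable_scaled_of_sum_le h0 le_rfl hsum
  refine ⟨hs, ?_, 1, isAlgebraic_one, ?_⟩
  · have e : ∑' n, scaled (1 + termSeries) n =
        1 + 1 / 4 * ((∑' n, scaled (1 + termSeries) n) * ∑' n, scaled (1 + termSeries) n) := by
      conv_lhs => rw [one_add_termSeries]
      rw [tsum_scaled_add scaled_one_summable
        (summable_scaled_mul scaled_X_summable (summable_scaled_mul hs hs)), tsum_scaled_one,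
        tsum_scaled_mul scaled_X_summable (summable_scaled_mul hs hs), tsum_scaled_X,
        tsum_scaled_mul hs hs]
    have : ∑' n, scaled (1 + termSeries) n = 2 := by nlinarith
    rw [this]
    exact_mod_cast isAlgebraic_ratCast 2
  · simp_rw [scaled_one_add_termSeries, div_self (catScaled_pos _).ne']
    exact tendsto_const_nhds

lemma algCatalan_termSeries : AlgCatalan termSeries := by
  simpa using algCatalan_one_add_termSeries.add (AlgCatalan.one.smul (-1))

lemma algCatalan_subSeries : AlgCatalan subSeries := by
  rw [subSeries_eq]
  exact AlgCatalan.geom.mul (AlgCatalan.X.mul algCatalan_one_add_termSeries)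

/-- The part of a function on chains coming from a single closure. -/
def closPart : (LTerm × List LSub → ℚ) →ₗ[ℚ] (LTerm → ℚ) where
  toFun F
    | .clos a s => F (a, [s])
    | _ => 0
  map_add' F G := by funext t; cases t <;> simp
  map_smul' c F := by funext t; cases t <;> simp

open Classical in
lemma ind_eq_add (k : ℕ) : ind k = idxFn (fun _ => if k = 0 then 1 else 0) + lamFn (ind k) +
    ∑ p ∈ HasAntidiagonal.antidiagonal k, appFn (ind p.1) (ind p.2) + closPart (chainInd k 1) := by
  funext t
  simp only [Pi.add_apply, Finset.sum_apply]
  cases t with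
  | idx n => simp [idxFn, lamFn, appFn, closPart, ind_idx]
  | lam a => simp [idxFn, lamFn, appFn, closPart, ind, normIn_lam]
  | app a b =>
    simp only [idxFn, lamFn, appFn, closPart, ind, normIn_app, LinearMap.coe_mk, AddHom.coe_mk]
    rw [sum_antidiagonal_ite fun i j h h' => normIn_unique h h']
    simp
  | clos a s => simp [idxFn, lamFn, appFn, closPart, ind, chainInd]

/-- The generating function of the normal forms. -/
noncomputable def pureSeries : ℝ⟦X⟧ := gf (ind 0)

lemma pureSeries_eq_add :
    pureSeries = X * (geom + pureSeries + pureSeries * pureSeries) := by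
  have h : ind 0 = idxFn 1 + lamFn (ind 0) + appFn (ind 0) (ind 0) := by
    conv_lhs => rw [ind_eq_add, chainInd_eq_zero Nat.zero_lt_one]
    simp
    rfl
  conv_lhs => rw [pureSeries, h]
  rw [map_add, map_add, gf_idxFn_one, gf_lamFn, gf_appFn]
  simp only [pureSeries]
  ring

lemma ind_nonneg (k : ℕ) (t : LTerm) : 0 ≤ ind k t := by
  unfold ind; split_ifs <;> simp

lemma coeff_pureSeries_nonneg (n : ℕ) : 0 ≤ coeff n pureSeries := coeff_gf_nonneg (ind_nonneg 0) n

lemma sum_pureSeries_le (n : ℕ) :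
    ∑ i ∈ range n, coeff i pureSeries * (29 / 100) ^ i ≤ (6 / 5 : ℝ) := by
  induction n with
  | zero => norm_num
  | succ n ih =>
    have h1 := sum_coeff_mul_le coeff_pureSeries_nonneg coeff_pureSeries_nonneg
      (r := 29 / 100) (by norm_num) n
    have hn : 0 ≤ ∑ i ∈ range n, coeff i pureSeries * (29 / 100) ^ i :=
      Finset.sum_nonneg fun i _ => mul_nonneg (coeff_pureSeries_nonneg i) (by positivity)
    have hg : ∑ i ∈ range n, coeff i geom * (29 / 100 : ℝ) ^ i ≤ 100 / 71 := by
      simp only [geom, coeff_mk, one_mul]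
      refine ((summable_geometric_of_lt_one (by norm_num) (by norm_num)).sum_le_tsum _
        fun i _ => by positivity).trans_eq ?_
      rw [tsum_geometric_of_lt_one (by norm_num) (by norm_num)]
      norm_num
    rw [pureSeries_eq_add, sum_coeff_X_mul]
    simp only [map_add, add_mul, Finset.sum_add_distrib]
    nlinarith

lemma summable_scaled_pureSeries : Summable fun n => |scaled pureSeries n| :=
  summable_scaled_of_sum_le coeff_pureSeries_nonneg (by norm_num) sum_pureSeries_le

lemma algCatalan_pureSeries : AlgCatalan pureSeries := by
  refine AlgCatalan.of_sum_le coeff_pureSeries_nonneg (r := 29 / 100) (by norm_num)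
    sum_pureSeries_le ?_
  have hs := summable_scaled_pureSeries
  have hg := AlgCatalan.geom.summable
  have e : ∑' n, scaled pureSeries n = 1 / 4 * (∑' n, scaled geom n +
      ∑' n, scaled pureSeries n + (∑' n, scaled pureSeries n) *
      ∑' n, scaled pureSeries n) := by
    have hadd := summable_scaled_add hg hs
    have hadd' := summable_scaled_add hadd (summable_scaled_mul hs hs)
    conv_lhs => rw [pureSeries_eq_add]
    rw [tsum_scaled_mul scaled_X_summable hadd', tsum_scaled_X,
      tsum_scaled_add hadd (summable_scaled_mul hs hs), tsum_scaled_add hg hs,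
      tsum_scaled_mul hs hs]
  generalize ∑' n, scaled pureSeries n = x at e
  rw [tsum_scaled_geom] at e
  refine ⟨3 * Polynomial.X ^ 2 - 9 * Polynomial.X + 4, ?_, ?_⟩
  · intro h
    have := congrArg (Polynomial.eval 0) h
    norm_num at this
  · simp only [map_add, map_sub, map_mul, map_pow, Polynomial.aeval_X, map_ofNat]
    linarith

end Systems

section Resolvent

/-- The series `1 + 2 * L`, where `L` counts the normal forms. -/
noncomputable def kernelSeries : ℝ⟦X⟧ := 1 + pureSeries + pureSeries

/-- The series `1 / (1 - z - 2 * z * L)`, where `L` counts the normal forms. -/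
noncomputable def resolventSeries : ℝ⟦X⟧ := (1 - X * kernelSeries)⁻¹

lemma resolventSeries_mul : (1 - X * kernelSeries) * resolventSeries = 1 :=
  PowerSeries.mul_inv_cancel _ (by simp)

lemma resolventSeries_eq : resolventSeries = 1 + X * (kernelSeries * resolventSeries) := by
  linear_combination resolventSeries_mul

lemma coeff_one_nonneg (n : ℕ) : 0 ≤ coeff n (1 : ℝ⟦X⟧) := by
  rw [coeff_one]; split_ifs <;> norm_num

lemma coeff_kernelSeries_nonneg (n : ℕ) : 0 ≤ coeff n kernelSeries := by
  rw [kernelSeries, map_add, map_add]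
  exact add_nonneg (add_nonneg (coeff_one_nonneg n) (coeff_pureSeries_nonneg n))
    (coeff_pureSeries_nonneg n)

lemma coeff_resolventSeries_nonneg (n : ℕ) : 0 ≤ coeff n resolventSeries := by
  induction n using Nat.strong_induction_on with
  | _ n ih =>
    rw [resolventSeries_eq, map_add]
    refine add_nonneg (coeff_one_nonneg n) ?_
    cases n with
    | zero => rw [coeff_zero_X_mul]
    | succ n =>
      rw [coeff_succ_X_mul, coeff_mul]
      refine Finset.sum_nonneg fun p hp => mul_nonneg (coeff_kernelSeries_nonneg _) (ih _ ?_)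
      have := HasAntidiagonal.mem_antidiagonal.mp hp
      omega

lemma sum_coeff_one_le (r : ℝ) (n : ℕ) :
    ∑ i ∈ range n, coeff i (1 : ℝ⟦X⟧) * r ^ i ≤ 1 := by
  simp only [coeff_one, ite_mul, one_mul, zero_mul, Finset.sum_ite_eq']
  split_ifs <;> simp

lemma sum_kernelSeries_le (n : ℕ) :
    ∑ i ∈ range n, coeff i kernelSeries * (29 / 100) ^ i ≤ (17 / 5 : ℝ) := by
  simp only [kernelSeries, map_add, add_mul, Finset.sum_add_distrib]
  linarith [sum_pureSeries_le n, sum_coeff_one_le (29 / 100) n]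

lemma sum_resolventSeries_le (n : ℕ) :
    ∑ i ∈ range n, coeff i resolventSeries * (29 / 100) ^ i ≤ (100 : ℝ) := by
  induction n with
  | zero => norm_num
  | succ n ih =>
    have h1 := sum_coeff_mul_le coeff_kernelSeries_nonneg coeff_resolventSeries_nonneg
      (r := 29 / 100) (by norm_num) n
    have hk := sum_kernelSeries_le n
    have hn : 0 ≤ ∑ i ∈ range n, coeff i resolventSeries * (29 / 100) ^ i :=
      Finset.sum_nonneg fun i _ => mul_nonneg (coeff_resolventSeries_nonneg i) (by positivity)
    have h2 := mul_le_mul hk ih hn (by norm_num)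
    have h3 := sum_coeff_one_le (29 / 100) (n + 1)
    rw [resolventSeries_eq]
    simp only [map_add, add_mul, Finset.sum_add_distrib]
    rw [sum_coeff_X_mul]
    linarith

lemma algCatalan_kernelSeries : AlgCatalan kernelSeries :=
  (AlgCatalan.one.add algCatalan_pureSeries).add algCatalan_pureSeries

lemma algCatalan_resolventSeries : AlgCatalan resolventSeries := by
  refine AlgCatalan.of_sum_le coeff_resolventSeries_nonneg (r := 29 / 100) (by norm_num)
    sum_resolventSeries_le ?_
  have hs : Summable fun n => |scaled resolventSeries n| :=
    summable_scaled_of_sum_le coeff_resolventSeries_nonneg (by norm_num) sum_resolventSeries_le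
  have hk := algCatalan_kernelSeries
  have e : ∑' n, scaled resolventSeries n =
      1 + 1 / 4 * ((∑' n, scaled kernelSeries n) * ∑' n, scaled resolventSeries n) := by
    have hks := summable_scaled_mul hk.summable hs
    conv_lhs => rw [resolventSeries_eq]
    rw [tsum_scaled_add scaled_one_summable (summable_scaled_mul scaled_X_summable hks),
      tsum_scaled_one, tsum_scaled_mul scaled_X_summable hks, tsum_scaled_X,
      tsum_scaled_mul hk.summable hs]
  have hv := hk.value
  generalize ∑' n, scaled resolventSeries n = u at e
  generalize ∑' n, scaled kernelSeries n = d at e hv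
  have hu : u = (1 - ((1 / 4 : ℚ) : ℝ) * d)⁻¹ := by
    refine eq_inv_of_mul_eq_one_left ?_
    push_cast
    linarith
  rw [hu]
  exact (isAlgebraic_one.sub ((isAlgebraic_ratCast _).mul hv)).inv

end Resolvent

section Levels

/-- All functions of complexity `w` have an `AlgCatalan` generating function. -/
def LevelAlgCatalan (w : ℕ) : Prop :=
  (∀ f ∈ termLevel w, AlgCatalan (gf f)) ∧ ∀ g ∈ subLevel w, AlgCatalan (gf g)

lemma algCatalan_of_span {α : Type} [FinSized α] {s : Set (α → ℚ)} {T : (α → ℚ) →ₗ[ℚ] (α → ℚ)}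
    (h : ∀ f ∈ s, AlgCatalan (gf (T f))) {f : α → ℚ} (hf : f ∈ Submodule.span ℚ s) :
    AlgCatalan (gf (T f)) := by
  suffices h' : Submodule.span ℚ s ≤ algCatalan.comap (gf ∘ₗ T) from h' hf
  rw [Submodule.span_le]
  exact h

lemma levelAlgCatalan_zero : LevelAlgCatalan 0 := by
  refine ⟨fun f hf => ?_, fun g hg => ?_⟩
  · refine algCatalan_of_span (T := LinearMap.id) (fun f hf => ?_) hf
    cases hf with
    | one => exact algCatalan_termSeries
    | @ind i hi =>
      obtain rfl : i = 0 := by omega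
      exact algCatalan_pureSeries
  · refine algCatalan_of_span (T := LinearMap.id) (fun f hf => ?_) hg
    rw [Set.mem_singleton_iff.mp hf]
    exact algCatalan_subSeries

lemma closFn_mul_closPart_pureTensor (f f' : LTerm → ℚ) (h : LSub → ℚ) (gs : List (LSub → ℚ)) :
    closFn f h * closPart (pureTensor f' gs) = 0 ∨
      ∃ g, gs = [g] ∧ closFn f h * closPart (pureTensor f' gs) = closFn (f * f') (h * g) := by
  rcases gs with _ | ⟨g, _ | ⟨g', gs⟩⟩
  · left
    funext t; cases t <;> simp [closFn, closPart, pureTensor, evalList]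
  · refine .inr ⟨g, rfl, ?_⟩
    funext t; cases t <;> simp [closFn, closPart, pureTensor, evalList]; ring
  · left
    funext t; cases t <;> simp [closFn, closPart, pureTensor, evalList]

lemma algCatalan_closFn_mul {w i : ℕ} (hw : LevelAlgCatalan w) (hi : 2 * i ≤ w + 1)
    {f : LTerm → ℚ} {h : LSub → ℚ} (hf : f ∈ termLevel w) (hh : h ∈ subLevel w) :
    AlgCatalan (gf (closFn f h * closPart (chainInd i 1))) := by
  refine map_mem_of_pureTensor (S := algCatalan)
    (gf ∘ₗ LinearMap.mulLeft ℚ (closFn f h) ∘ₗ closPart) (fun f' hf' gs hgs => ?_)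
    (chainInd_mem w i 1 hi)
  simp only [LinearMap.comp_apply, LinearMap.mulLeft_apply]
  rcases closFn_mul_closPart_pureTensor f f' h gs with e | ⟨g, rfl, e⟩
  · rw [e, map_zero]; exact zero_mem _
  · rw [e, gf_closFn]
    exact AlgCatalan.X.mul ((hw.1 _ (mul_mem_termLevel hf hf')).mul
      (hw.2 _ (mul_mem_subLevel hh (hgs g (by simp)))))

lemma algCatalan_gf_ind {w i : ℕ} (hw : LevelAlgCatalan w) (hi : 2 * i ≤ w + 1)
    (ih : ∀ j < i, AlgCatalan (gf (ind j))) : AlgCatalan (gf (ind i)) := by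
  rcases Nat.eq_zero_or_pos i with rfl | hpos
  · exact algCatalan_pureSeries
  set R := ((HasAntidiagonal.antidiagonal i).erase (0, i)).erase (i, 0) with hR
  have hc : closPart (chainInd i 1) = closFn 1 1 * closPart (chainInd i 1) := by
    funext t; cases t <;> simp [closPart, closFn]
  have hz : idxFn (fun _ => if i = 0 then 1 else 0) = 0 := by
    funext t; cases t <;> simp [idxFn, hpos.ne']
  have e : gf (ind i) = resolventSeries *
      (X * ∑ p ∈ R, gf (ind p.1) * gf (ind p.2) + gf (closFn 1 1 * closPart (chainInd i 1))) := by
    have h1 : gf (ind i) = X * gf (ind i) +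
        (X * (gf (ind 0) * gf (ind i)) + (X * (gf (ind i) * gf (ind 0)) +
          ∑ p ∈ R, X * (gf (ind p.1) * gf (ind p.2)))) +
        gf (closFn 1 1 * closPart (chainInd i 1)) := by
      conv_lhs => rw [ind_eq_add, hz, zero_add]
      rw [map_add, map_add, gf_lamFn, map_sum, ← hc]
      simp_rw [gf_appFn]
      rw [← Finset.add_sum_erase _ _ (show (0, i) ∈ HasAntidiagonal.antidiagonal i by simp),
        ← Finset.add_sum_erase _ _ (show (i, 0) ∈ (HasAntidiagonal.antidiagonal i).erase (0, i) by
          simp [hpos.ne'])]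
    rw [← Finset.mul_sum] at h1
    have h2 := resolventSeries_mul
    rw [kernelSeries] at h2
    simp only [pureSeries] at h2
    linear_combination resolventSeries * h1 - gf (ind i) * h2
  rw [e]
  refine algCatalan_resolventSeries.mul ((AlgCatalan.X.mul ?_).add
    (algCatalan_closFn_mul hw hi (one_mem_termLevel w) (one_mem_subLevel w)))
  refine mem_algCatalan.mp (Submodule.sum_mem _ fun p hp => ?_)
  simp only [hR, Finset.mem_erase, HasAntidiagonal.mem_antidiagonal, ne_eq, Prod.ext_iff] at hp
  exact (ih _ (by omega)).mul (ih _ (by omega))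

lemma idxFn_mul_ind (p : ℕ → ℚ) (i : ℕ) :
    idxFn p * ind i = idxFn (p * fun _ => if i = 0 then 1 else 0) := by
  funext t; cases t <;> simp [idxFn, ind_idx]

open Classical in
lemma lamFn_mul_ind (f : LTerm → ℚ) (i : ℕ) : lamFn f * ind i = lamFn (f * ind i) := by
  funext t; cases t <;> simp [lamFn, ind, normIn_lam]

lemma appFn_mul_ind (f g : LTerm → ℚ) (i : ℕ) : appFn f g * ind i =
    ∑ p ∈ HasAntidiagonal.antidiagonal i, appFn (f * ind p.1) (g * ind p.2) := by
  rw [ind_eq_add, mul_add, mul_add, mul_add, Finset.mul_sum]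
  simp_rw [appFn_mul]
  have h1 : appFn f g * idxFn (fun _ => if i = 0 then 1 else 0) = 0 := by
    funext t; cases t <;> simp [appFn, idxFn]
  have h2 : appFn f g * lamFn (ind i) = 0 := by
    funext t; cases t <;> simp [appFn, lamFn]
  have h3 : appFn f g * closPart (chainInd i 1) = 0 := by
    funext t; cases t <;> simp [appFn, closPart]
  rw [h1, h2, h3, zero_add, zero_add, add_zero]

open Classical in
lemma closFn_mul_ind (f : LTerm → ℚ) (h : LSub → ℚ) (i : ℕ) :
    closFn f h * ind i = closFn f h * closPart (chainInd i 1) := by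
  funext t; cases t <;> simp [closFn, closPart, chainInd, ind]

lemma algCatalan_mul_ind {w : ℕ} (hw : LevelAlgCatalan w) :
    ∀ i, 2 * i ≤ w + 1 → ∀ v ≤ w + 1, ∀ f ∈ termLevel v, AlgCatalan (gf (f * ind i)) := by
  intro i
  induction i using Nat.strong_induction_on with
  | _ i ihi =>
    intro hi
    have hind : AlgCatalan (gf (ind i)) := algCatalan_gf_ind hw hi fun j hj => by
      simpa using ihi j hj (by omega) 0 (Nat.zero_le _) 1 (one_mem_termLevel 0)
    have hzero : AlgCatalan (gf (0 : LTerm → ℚ)) := by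
      rw [map_zero]; exact algCatalan.zero_mem
    intro v
    induction v with
    | zero =>
      intro _ f hf
      refine algCatalan_of_span (T := LinearMap.mulRight ℚ (ind i)) (fun f hf => ?_) hf
      rw [LinearMap.mulRight_apply]
      cases hf with
      | one => rwa [one_mul]
      | @ind j hj =>
        rw [ind_mul_ind]
        split_ifs with h
        · rwa [h]
        · exact hzero
    | succ v ihv =>
      intro hv f hf
      refine algCatalan_of_span (T := LinearMap.mulRight ℚ (ind i)) (fun f hf => ?_) hf
      rw [LinearMap.mulRight_apply]
      obtain ⟨b, e, hb, he, rfl⟩ := hf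
      have he' : e * ind i = ind i ∨ e * ind i = 0 := by
        cases he with
        | one => exact .inl (one_mul _)
        | @ind j hj =>
          rw [ind_mul_ind]
          split_ifs with h
          · exact .inl (by rw [h])
          · exact .inr rfl
      rw [mul_assoc]
      rcases he' with h | h
      swap
      · rw [h, mul_zero]; exact hzero
      rw [h]
      have hle : ∀ j ≤ i, ∀ f ∈ termLevel v, AlgCatalan (gf (f * ind j)) := fun j hj f hf => by
        rcases hj.eq_or_lt with rfl | hj
        · exact ihv (by omega) f hf
        · exact ihi j hj (by omega) v (by omega) f hf
      cases hb with
      | idx hp =>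
        rw [idxFn_mul_ind]
        exact AlgCatalan.gf_idxFn (hp.mul (evConst_const _))
      | lam hf =>
        rw [lamFn_mul_ind, gf_lamFn]
        exact AlgCatalan.X.mul (hle i le_rfl _ hf)
      | app hf hg =>
        rw [appFn_mul_ind, map_sum]
        refine mem_algCatalan.mp (Submodule.sum_mem _ fun p hp => ?_)
        rw [gf_appFn]
        have := HasAntidiagonal.mem_antidiagonal.mp hp
        exact AlgCatalan.X.mul ((hle _ (by omega) _ hf).mul (hle _ (by omega) _ hg))
      | clos hf hh =>
        rw [closFn_mul_ind]
        exact algCatalan_closFn_mul hw hi (termLevel_mono (by omega) hf)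
          (subLevel_mono (by omega) hh)

lemma LevelAlgCatalan.succ {w : ℕ} (hw : LevelAlgCatalan w) : LevelAlgCatalan (w + 1) := by
  refine ⟨fun f hf => ?_, fun g hg => ?_⟩
  · refine algCatalan_of_span (T := LinearMap.id) (fun f hf => ?_) hf
    obtain ⟨b, e, hb, he, rfl⟩ := hf
    rw [LinearMap.id_apply]
    cases he with
    | one =>
      rw [mul_one]
      cases hb with
      | idx hp => exact AlgCatalan.gf_idxFn hp
      | lam hf =>
        rw [gf_lamFn]
        exact AlgCatalan.X.mul (hw.1 _ hf)
      | app hf hg =>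
        rw [gf_appFn]
        exact AlgCatalan.X.mul ((hw.1 _ hf).mul (hw.1 _ hg))
      | clos hf hh =>
        rw [gf_closFn]
        exact AlgCatalan.X.mul ((hw.1 _ hf).mul (hw.2 _ hh))
    | ind hi => exact algCatalan_mul_ind hw _ hi _ le_rfl _ hb.mem
  · refine algCatalan_of_span (T := LinearMap.id) (fun f hf => ?_) hg
    rw [LinearMap.id_apply]
    cases hf with
    | slash hf =>
      rw [gf_slashFn]
      exact AlgCatalan.X.mul (hw.1 _ hf)
    | lift hg =>
      rw [gf_liftFn]
      exact AlgCatalan.X.mul (hw.2 _ hg)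
    | shift =>
      rw [gf_shiftFn]
      exact AlgCatalan.X

lemma levelAlgCatalan (w : ℕ) : LevelAlgCatalan w := by
  induction w with
  | zero => exact levelAlgCatalan_zero
  | succ w ih => exact ih.succ

end Levels

lemma normCount_eq_coeff (k n : ℕ) : (normCount k n : ℝ) = coeff n (gf (ind k)) := by
  classical
  have e : {t : LTerm | t.size = n ∧ NormIn t k} =
      (((ofSize LTerm n).filter fun t => NormIn t k : Finset LTerm) : Set LTerm) := by
    ext t
    simp [mem_ofSize, FinSized.size]
  have h : normCount k n = ((ofSize LTerm n).filter fun t => NormIn t k).card := by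
    rw [← Set.ncard_coe_finset, ← e]
    rfl
  rw [h, coeff_gf, Finset.card_filter, Nat.cast_sum]
  refine Finset.sum_congr rfl fun t _ => ?_
  unfold ind
  split_ifs <;> simp

lemma termCount_eq_coeff (n : ℕ) : (termCount n : ℝ) = coeff n termSeries := by
  have e : {t : LTerm | t.size = n} = ((ofSize LTerm n : Finset LTerm) : Set LTerm) := by
    ext t
    simp [mem_ofSize, FinSized.size]
  have h : termCount n = (ofSize LTerm n).card := by
    rw [← Set.ncard_coe_finset, ← e]
    rfl
  rw [h, termSeries, coeff_gf]
  simp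

lemma termCount_succ (n : ℕ) : (termCount (n + 1) : ℝ) = catalan (n + 1) := by
  rw [← coeff_one_add_termSeries, termCount_eq_coeff, map_add, coeff_one,
    if_neg (Nat.succ_ne_zero n), zero_add]

lemma exists_isAlgebraic_tendsto (k : ℕ) : ∃ α : ℝ, IsAlgebraic ℚ α ∧
    Tendsto (fun n => (normCount k n : ℝ) / termCount n) atTop (𝓝 α) := by
  obtain ⟨α, hα, h⟩ :=
    ((levelAlgCatalan (2 * k)).1 _ (ind_mem_termLevel le_rfl)).limit
  refine ⟨α, hα, h.congr' ?_⟩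
  filter_upwards [eventually_ge_atTop 1] with n hn
  obtain ⟨n, rfl⟩ := Nat.exists_eq_add_of_le' hn
  rw [termCount_succ, normCount_eq_coeff, scaled, catScaled,
    mul_div_mul_right _ _ (by positivity)]

end LambdaUpsilon

/-- For each k ≥ 0, the asymptotic density μ_k = lim_{n→∞} g_n^{(k)}/t_n is an
algebraic real number, i.e. a root of a non-zero polynomial with rational
coefficients. -/
theorem density_algebraic (k : ℕ) (μ : ℝ)
    (hμ : Filter.Tendsto (fun n : ℕ => (normCount k n : ℝ) / (termCount n : ℝ))
      Filter.atTop (nhds μ)) :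
    IsAlgebraic ℚ μ := by
  obtain ⟨α, hα, h⟩ := LambdaUpsilon.exists_isAlgebraic_tendsto k
  rw [tendsto_nhds_unique hμ h]
  exact hα
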